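/- arXiv:2604.15511 — 5 statements merged into one kernel-verified Lean document; each statement's English description precedes it below -/
import Mathlib

section
/- Assume the setup. Let Γ = (T, m, λ) be a stable [n]-marked metric tree with at most r edges that satisfies condition (H_q) for every q ∈ {1,…,r}. Then: (1) T has exactly r edges; (2) for each q ∈ {1,…,r} there is a unique edge e_q of T with (1/2)·B^(n−3−q) ≤ λ(e_q) ≤ n·B^(n−3−q), the edges e_1, …, e_r are pairwise distinct, and λ(e_1) > λ(e_2) > ⋯ > λ(e_r); (3) for each q ∈ {1,…,r} and every pair k < ℓ in S_q ∖ {i_q, j_q} at which the minimum in (H_q) is attained, the edge e_q lies both on the path between m(i_q) and m(j_q) and on the path between m(k) and m(ℓ), while no edge e_{q'} with q' < q lies on both of these paths; (4) for each q ∈ {1,…,r}, the minimum in (H_q) is attained for exactly two values of α. (Paper: Lemma on combinatorics of points of Σ_r ∩ ⋂_{q=1}^r Trop(H_q), Section 6.) -/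
open scoped Classical

namespace TropPsi

/-- A finite tree with vertices marked by `Fin n` (the `n` legs). -/
structure MTree (n : ℕ) where
  V : Type
  [fintypeV : Fintype V]
  [decEqV : DecidableEq V]
  G : SimpleGraph V
  isTree : G.IsTree
  mark : Fin n → V

attribute [instance] MTree.fintypeV MTree.decEqV

namespace MTree

variable {n : ℕ}

/-- The unique path between two vertices of a tree, as a walk. -/
noncomputable def path (τ : MTree n) (u v : τ.V) : τ.G.Walk u v :=
  (τ.isTree.existsUnique_path u v).exists.choose

/-- An edge lies on the path between `u` and `v`. -/
def onPath (τ : MTree n) (u v : τ.V) (e : Sym2 τ.V) : Prop :=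
  e ∈ (τ.path u v).edges

/-- The set of edges lying both on the path between legs `i` and `j` and on the
path between legs `k` and `l`. -/
def PathSet (τ : MTree n) (i j k l : Fin n) : Set (Sym2 τ.V) :=
  {e | τ.onPath (τ.mark i) (τ.mark j) e ∧ τ.onPath (τ.mark k) (τ.mark l) e}

/-- Stability: at every vertex, degree plus number of legs is at least `3`. -/
def Stable (τ : MTree n) : Prop :=
  ∀ v : τ.V, 3 ≤ {w : τ.V | τ.G.Adj v w}.ncard + {α : Fin n | τ.mark α = v}.ncard

end MTree

/-- A stable `[n]`-marked metric tree: a marked tree together with a length function. -/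
structure MMTree (n : ℕ) extends MTree n where
  len : Sym2 V → ℝ

/-- Equip a marked tree with a length function. -/
def MTree.withLen {n : ℕ} (τ : MTree n) (lam : Sym2 τ.V → ℝ) : MMTree n :=
  { toMTree := τ, len := lam }

namespace MMTree

variable {n : ℕ}

/-- All edges have positive length. -/
def PosLen (Γ : MMTree n) : Prop :=
  ∀ e ∈ Γ.G.edgeSet, 0 < Γ.len e

/-- The distance `d(α,β)` between the legs `α` and `β`. -/
noncomputable def legDist (Γ : MMTree n) (α β : Fin n) : ℝ :=
  ((Γ.toMTree.path (Γ.mark α) (Γ.mark β)).edges.map Γ.len).sum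

/-- The projection coordinate `d_l^{(i,j)}`. -/
noncomputable def proj (Γ : MMTree n) (i j l : Fin n) : ℝ :=
  (Γ.legDist i l + Γ.legDist i j - Γ.legDist j l) / 2

/-- The quantity `d_α^{(i,j)} + α · c` being minimized in condition `(H_q)`;
the leg `α : Fin n` has numerical value `α + 1 ∈ {1, …, n}`. -/
noncomputable def hval (Γ : MMTree n) (i j : Fin n) (c : ℝ) (α : Fin n) : ℝ :=
  Γ.proj i j α + (((α : ℕ) : ℝ) + 1) * c

/-- `α` attains the minimum of `d^{(i,j)} + (·) · c` over `S \ {i, j}`. -/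
def Minimizes (Γ : MMTree n) (S : Finset (Fin n)) (i j : Fin n) (c : ℝ) (α : Fin n) : Prop :=
  α ∈ S \ {i, j} ∧ ∀ γ ∈ S \ {i, j}, Γ.hval i j c α ≤ Γ.hval i j c γ

/-- Condition `(H)`: the minimum is attained at least twice. -/
def CondH (Γ : MMTree n) (S : Finset (Fin n)) (i j : Fin n) (c : ℝ) : Prop :=
  ∃ α β : Fin n, α ≠ β ∧ Γ.Minimizes S i j c α ∧ Γ.Minimizes S i j c β

end MMTree

namespace MTree

variable {n : ℕ} (τ : MTree n)

lemma path_isPath (u v : τ.V) : (τ.path u v).IsPath :=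
  (τ.isTree.existsUnique_path u v).exists.choose_spec

lemma onPath_iff_not_reachable (u v : τ.V) (e : Sym2 τ.V) :
    τ.onPath u v e ↔ ¬ (τ.G.deleteEdges {e}).Reachable u v := by
  refine ⟨?_, fun h => (τ.path u v).mem_edges_of_not_reachable_deleteEdges h⟩
  rintro he ⟨w⟩
  have hw : e ∉ (w.mapLe (τ.G.deleteEdges_le {e})).edges := by
    rw [SimpleGraph.Walk.edges_mapLe_eq_edges]
    intro h
    simpa using w.edges_subset_edgeSet h
  have hp : τ.path u v = ((w.mapLe (τ.G.deleteEdges_le {e})).toPath : τ.G.Walk u v) :=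
    (τ.isTree.existsUnique_path u v).unique (τ.path_isPath u v) (SimpleGraph.Path.isPath _)
  unfold MTree.onPath at he
  rw [hp] at he
  exact hw (SimpleGraph.Walk.edges_toPath_subset_edges _ he)

/-- Deleting an edge of a tree leaves at most two components, separated by a predicate. -/
lemma exists_side (e : Sym2 τ.V) :
    ∃ s : τ.V → Prop, ∀ u v, τ.onPath u v e ↔ ¬ (s u ↔ s v) := by
  induction e with | _ a b
  have key : ∀ {x y : τ.V}, τ.G.Walk x y → y = a →
      (τ.G.deleteEdges {s(a, b)}).Reachable x a ∨ (τ.G.deleteEdges {s(a, b)}).Reachable x b := by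
    intro x y w hy
    induction w with
    | nil => subst hy; exact Or.inl .rfl
    | @cons x z y h w ih =>
      by_cases hxz : s(x, z) = s(a, b)
      · rcases Sym2.eq_iff.1 hxz with ⟨rfl, -⟩ | ⟨rfl, -⟩
        · exact Or.inl .rfl
        · exact Or.inr .rfl
      · have hadj : (τ.G.deleteEdges {s(a, b)}).Adj x z := by
          simpa [SimpleGraph.deleteEdges_adj, h] using hxz
        exact (ih hy).imp hadj.reachable.trans hadj.reachable.trans
  have key' : ∀ x, (τ.G.deleteEdges {s(a, b)}).Reachable x a ∨
      (τ.G.deleteEdges {s(a, b)}).Reachable x b := fun x => key (τ.path x a) rfl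
  refine ⟨fun u => (τ.G.deleteEdges {s(a, b)}).Reachable u a, fun u v => ?_⟩
  rw [onPath_iff_not_reachable, not_iff_not]
  constructor
  · exact fun h => ⟨h.symm.trans, h.trans⟩
  · intro h
    by_cases hu : (τ.G.deleteEdges {s(a, b)}).Reachable u a
    · exact hu.trans (h.1 hu).symm
    · have hv := mt h.2 hu
      exact ((key' u).resolve_left hu).trans ((key' v).resolve_left hv).symm

/-- If two pairs of vertices are joined by paths through a common edge `f` and avoiding
`e`, then all four vertices are on the same side of `e`. -/
lemma not_onPath_of_common_edge {u v x y : τ.V} {e f : Sym2 τ.V}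
    (hf : τ.onPath u x f) (hf' : τ.onPath v y f) (he : ¬ τ.onPath u x e) (he' : ¬ τ.onPath v y e) :
    ¬ τ.onPath u v e := by
  have main : ∀ {u x a : τ.V}, ¬ τ.onPath u x e → a ∈ (τ.path u x).support →
      (τ.G.deleteEdges {e}).Reachable u a := by
    intro u x a he ha
    by_contra h
    exact he ((τ.path u x).edges_takeUntil_subset_edges ha
      (SimpleGraph.Walk.mem_edges_of_not_reachable_deleteEdges _ h))
  induction f with | _ a b
  rw [onPath_iff_not_reachable, not_not]
  exact (main he ((τ.path u x).fst_mem_support_of_mem_edges hf)).trans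
    (main he' ((τ.path v y).fst_mem_support_of_mem_edges hf')).symm

end MTree

namespace MMTree

variable {n : ℕ} (Γ : MMTree n)

lemma legDist_eq_sum (α β : Fin n) :
    Γ.legDist α β =
      ∑ e, if Γ.toMTree.onPath (Γ.mark α) (Γ.mark β) e then Γ.len e else 0 := by
  rw [legDist, ← List.sum_toFinset _
    (SimpleGraph.Walk.edges_nodup_of_support_nodup (Γ.toMTree.path_isPath _ _).support_nodup),
    ← Finset.sum_filter]
  refine Finset.sum_congr ?_ fun _ _ => rfl
  ext e
  rw [List.mem_toFinset, Finset.mem_filter]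
  exact ⟨fun h => ⟨Finset.mem_univ e, h⟩, fun h => h.2⟩

lemma proj_eq_sum (i j l : Fin n) :
    Γ.proj i j l = ∑ e, if Γ.toMTree.onPath (Γ.mark i) (Γ.mark j) e ∧
      Γ.toMTree.onPath (Γ.mark i) (Γ.mark l) e then Γ.len e else 0 := by
  rw [proj, legDist_eq_sum, legDist_eq_sum, legDist_eq_sum, ← Finset.sum_add_distrib,
    ← Finset.sum_sub_distrib, Finset.sum_div]
  refine Finset.sum_congr rfl fun e _ => ?_
  obtain ⟨s, hs⟩ := Γ.toMTree.exists_side e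
  simp only [hs]
  by_cases h1 : s (Γ.mark i) <;> by_cases h2 : s (Γ.mark j) <;> by_cases h3 : s (Γ.mark l) <;>
    simp [h1, h2, h3]

/-- The distance between the projections of `k` and `l` to the path from `i` to `j` is the length
of the common part of this path with the path from `k` to `l`. -/
lemma sum_pathSet_eq (i j k l : Fin n) (h : Γ.proj i j l < Γ.proj i j k)
    (hpos : Γ.PosLen) :
    ∑ e with e ∈ Γ.toMTree.PathSet i j k l, Γ.len e = Γ.proj i j k - Γ.proj i j l := by
  have hex : ∃ e, Γ.toMTree.onPath (Γ.mark i) (Γ.mark j) e ∧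
      Γ.toMTree.onPath (Γ.mark i) (Γ.mark k) e ∧ ¬ Γ.toMTree.onPath (Γ.mark i) (Γ.mark l) e := by
    by_contra! hno
    refine h.not_ge ?_
    rw [proj_eq_sum, proj_eq_sum]
    refine Finset.sum_le_sum fun e _ => ?_
    by_cases h1 : Γ.toMTree.onPath (Γ.mark i) (Γ.mark j) e
    · have := (hpos e (SimpleGraph.Walk.edges_subset_edgeSet _ h1)).le
      have := hno e h1
      split_ifs <;> tauto
    · simp [h1]
  obtain ⟨e, hij, hik, hil⟩ := hex
  have hjk : ¬ Γ.toMTree.onPath (Γ.mark j) (Γ.mark k) e := by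
    obtain ⟨s, hs⟩ := Γ.toMTree.exists_side e
    simp only [hs] at *
    tauto
  rw [proj_eq_sum, proj_eq_sum, ← Finset.sum_sub_distrib, Finset.sum_filter]
  refine Finset.sum_congr rfl fun f _ => ?_
  have hcross : Γ.toMTree.onPath (Γ.mark i) (Γ.mark l) f →
      ¬ Γ.toMTree.onPath (Γ.mark j) (Γ.mark k) f := fun h1 h2 =>
    Γ.toMTree.not_onPath_of_common_edge h1 h2 hil hjk hij
  obtain ⟨s, hs⟩ := Γ.toMTree.exists_side f
  simp only [MTree.PathSet, Set.mem_ofPred_eq, hs] at *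
  by_cases h1 : s (Γ.mark i) <;> by_cases h2 : s (Γ.mark j) <;> by_cases h3 : s (Γ.mark l) <;>
    by_cases h4 : s (Γ.mark k) <;> simp_all

lemma notMem_pathSet_of_mem {i j a b c : Fin n} {e : Sym2 Γ.V}
    (h1 : e ∈ Γ.toMTree.PathSet i j a b) (h2 : e ∈ Γ.toMTree.PathSet i j a c) :
    e ∉ Γ.toMTree.PathSet i j b c := by
  obtain ⟨s, hs⟩ := Γ.toMTree.exists_side e
  simp only [MTree.PathSet, Set.mem_ofPred_eq, hs] at *
  tauto

lemma pathSet_comm (i j k l : Fin n) :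
    Γ.toMTree.PathSet i j k l = Γ.toMTree.PathSet i j l k := by
  ext e
  obtain ⟨s, hs⟩ := Γ.toMTree.exists_side e
  simp only [MTree.PathSet, Set.mem_ofPred_eq, hs]
  tauto

/-- The common part of the two paths determined by a pair of minimizers. -/
lemma sum_pathSet_eq_of_minimizes (hpos : Γ.PosLen) {S : Finset (Fin n)} {i j k l : Fin n} {c : ℝ}
    (hc : 0 < c) (hkl : k < l) (hk : Γ.Minimizes S i j c k) (hl : Γ.Minimizes S i j c l) :
    ∑ e with e ∈ Γ.toMTree.PathSet i j k l, Γ.len e = ((l : ℕ) - (k : ℕ) : ℝ) * c := by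
  have heq : Γ.hval i j c k = Γ.hval i j c l := le_antisymm (hk.2 l hl.1) (hl.2 k hk.1)
  have hlt : ((k : ℕ) : ℝ) < ((l : ℕ) : ℝ) := by exact_mod_cast hkl
  unfold hval at heq
  have hd : Γ.proj i j k - Γ.proj i j l = ((l : ℕ) - (k : ℕ) : ℝ) * c := by linarith
  rw [Γ.sum_pathSet_eq i j k l _ hpos, hd]
  have := mul_pos (sub_pos.2 hlt) hc
  linarith

end MMTree

/-- A tail bound for sequences decreasing geometrically with ratio at least `2 n + 1`. -/
lemma sum_Ioc_mul_add_le {n : ℝ} {r : ℕ} {c : ℕ → ℝ}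
    (hstep : ∀ q, 1 ≤ q → q < r → (2 * n + 1) * c (q + 1) ≤ c q)
    {p q : ℕ} (hp : 1 ≤ p) (hpq : p ≤ q) (hq : q ≤ r) :
    2 * n * ∑ x ∈ Finset.Ioc p q, c x + c q ≤ c p := by
  induction q, hpq using Nat.le_induction with
  | base => simp
  | succ q hpq ih =>
    rw [Finset.sum_Ioc_succ_top (by lia)]
    have := ih (by lia)
    have := hstep q (by lia) (by lia)
    linarith

lemma sum_biUnion_le_sum_sum {ι ε : Type*} {s : Finset ι} {P : ι → Finset ε} {f : ε → ℝ}
    (hf : ∀ i ∈ s, ∀ x ∈ P i, 0 ≤ f x) :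
    ∑ x ∈ s.biUnion P, f x ≤ ∑ i ∈ s, ∑ x ∈ P i, f x := by
  induction s using Finset.induction_on with
  | empty => simp
  | insert a s ha ih =>
    rw [Finset.biUnion_insert, Finset.sum_insert ha]
    have h1 := Finset.sum_union_inter (s₁ := P a) (s₂ := s.biUnion P) (f := f)
    have h2 : 0 ≤ ∑ x ∈ P a ∩ s.biUnion P, f x := Finset.sum_nonneg fun x hx =>
      hf a (Finset.mem_insert_self a s) x (Finset.mem_inter.1 hx).1
    have h3 := ih fun i hi => hf i (Finset.mem_insert_of_mem hi)
    linarith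

/-- If `r` subsets of a set of at most `r` positive weights have total weights in
`[c q, n * c q]`, where `c` decreases geometrically with a large ratio, then each subset contains
a weight of its own scale, and these are all the weights. -/
lemma exists_scale_representatives {ε : Type*} {E : Finset ε} {len : ε → ℝ}
    {n : ℝ} {r : ℕ} (hr : 1 ≤ r) {c : ℕ → ℝ} (hc : ∀ q, 0 < c q)
    (hstep : ∀ q, 1 ≤ q → q < r → (2 * n + 1) * c (q + 1) ≤ c q) (hpos : ∀ e ∈ E, 0 < len e)
    (hE : E.card ≤ r) {P : ℕ → Finset ε} (hP : ∀ q, 1 ≤ q → q ≤ r → P q ⊆ E)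
    (hlow : ∀ q, 1 ≤ q → q ≤ r → c q ≤ ∑ e ∈ P q, len e)
    (hup : ∀ q, 1 ≤ q → q ≤ r → ∑ e ∈ P q, len e ≤ n * c q) :
    E.card = r ∧ ∃ e : ℕ → ε,
      (∀ q, 1 ≤ q → q ≤ r → e q ∈ P q ∧ 1 / 2 * c q ≤ len (e q) ∧ len (e q) ≤ n * c q ∧
        ∀ q', 1 ≤ q' → q' < q → e q' ∉ P q) ∧
      ∀ x ∈ E, ∃ q, 1 ≤ q ∧ q ≤ r ∧ x = e q := by
  set U : ℕ → Finset ε := fun q => (Finset.Ioc q r).biUnion P with hU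
  set F : ℕ → Finset ε := fun q => P q \ U q with hF
  have hPpos : ∀ q, 1 ≤ q → q ≤ r → ∀ e ∈ P q, 0 < len e :=
    fun q h1 h2 e he => hpos e (hP q h1 h2 he)
  have hUsum : ∀ q, 1 ≤ q → q ≤ r →
      ∑ e ∈ P q ∩ U q, len e ≤ ∑ x ∈ Finset.Ioc q r, ∑ e ∈ P x, len e := by
    intro q h1 h2
    have hUpos : ∀ x ∈ Finset.Ioc q r, ∀ e ∈ P x, 0 ≤ len e := by
      intro x hx e he
      rw [Finset.mem_Ioc] at hx
      exact (hPpos x (by lia) hx.2 e he).le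
    refine le_trans (Finset.sum_le_sum_of_subset_of_nonneg Finset.inter_subset_right ?_)
      (sum_biUnion_le_sum_sum hUpos)
    intro e he _
    obtain ⟨x, hx, hex⟩ := Finset.mem_biUnion.1 he
    exact hUpos x hx e hex
  have hFsum : ∀ q, 1 ≤ q → q ≤ r → 1 / 2 * c q ≤ ∑ e ∈ F q, len e := by
    intro q h1 h2
    have e1 : ∑ x ∈ Finset.Ioc q r, ∑ e ∈ P x, len e ≤ n * ∑ x ∈ Finset.Ioc q r, c x := by
      rw [Finset.mul_sum]
      refine Finset.sum_le_sum fun x hx => ?_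
      rw [Finset.mem_Ioc] at hx
      exact hup x (by lia) hx.2
    have e2 := sum_Ioc_mul_add_le hstep h1 h2 le_rfl
    have e3 : ∑ e ∈ P q ∩ U q, len e + ∑ e ∈ F q, len e = ∑ e ∈ P q, len e :=
      Finset.sum_inter_add_sum_sdiff _ _ _
    have := hUsum q h1 h2
    have := hlow q h1 h2
    have := hc r
    linarith
  have hFne : ∀ q, 1 ≤ q → q ≤ r → (F q).Nonempty := by
    intro q h1 h2
    by_contra hne
    have h3 := hFsum q h1 h2
    rw [Finset.not_nonempty_iff_eq_empty.1 hne, Finset.sum_empty] at h3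
    linarith [hc q]
  have hFP : ∀ {q x q'}, x ∈ F q → q < q' → q' ≤ r → x ∉ P q' := by
    intro q x q' hx h1 h2 hx'
    exact (Finset.mem_sdiff.1 hx).2 (Finset.mem_biUnion.2 ⟨q', Finset.mem_Ioc.2 ⟨h1, h2⟩, hx'⟩)
  have hFdisj : ∀ {q q' x}, q ≤ r → q' ≤ r → x ∈ F q → x ∈ F q' → q = q' := by
    intro q q' x h1 h2 hx hx'
    rcases lt_trichotomy q q' with h | h | h
    · exact absurd (Finset.mem_sdiff.1 hx').1 (hFP hx h h2)
    · exact h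
    · exact absurd (Finset.mem_sdiff.1 hx).1 (hFP hx' h h1)
  have : Nonempty ε := ⟨(hFne 1 le_rfl hr).choose⟩
  choose! e he using hFne
  have hinj : Set.InjOn e (Finset.Icc 1 r : Finset ℕ) := by
    intro q hq q' hq' h
    simp only [Finset.coe_Icc, Set.mem_Icc] at hq hq'
    exact hFdisj hq.2 hq'.2 (he q hq.1 hq.2) (h ▸ he q' hq'.1 hq'.2)
  have himg : (Finset.Icc 1 r).image e = E := by
    refine Finset.eq_of_subset_of_card_le (fun x hx => ?_) ?_
    · obtain ⟨q, hq, rfl⟩ := Finset.mem_image.1 hx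
      rw [Finset.mem_Icc] at hq
      exact hP q hq.1 hq.2 (Finset.mem_sdiff.1 (he q hq.1 hq.2)).1
    · rw [Finset.card_image_of_injOn hinj]
      simpa using hE
  have hcover : ∀ x ∈ E, ∃ q, 1 ≤ q ∧ q ≤ r ∧ x = e q := by
    intro x hx
    rw [← himg] at hx
    obtain ⟨q, hq, rfl⟩ := Finset.mem_image.1 hx
    rw [Finset.mem_Icc] at hq
    exact ⟨q, hq.1, hq.2, rfl⟩
  refine ⟨?_, e, fun q h1 h2 => ?_, hcover⟩
  · rw [← himg, Finset.card_image_of_injOn hinj]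
    simp
  · have hPq := (Finset.mem_sdiff.1 (he q h1 h2)).1
    refine ⟨hPq, ?_, ?_, fun q' h1' h2' => hFP (he q' h1' (by lia)) h2' h2⟩
    · have hsing : F q = {e q} := by
        refine Finset.eq_singleton_iff_unique_mem.2 ⟨he q h1 h2, fun x hx => ?_⟩
        obtain ⟨q', h1', h2', rfl⟩ := hcover x (hP q h1 h2 (Finset.mem_sdiff.1 hx).1)
        rw [hFdisj h2 h2' hx (he q' h1' h2')]
      simpa [hsing] using hFsum q h1 h2
    · exact (Finset.single_le_sum (fun x hx => (hPpos q h1 h2 x hx).le) hPq).trans (hup q h1 h2)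

/-- Lemma on combinatorics of points of
`Σ_r ∩ ⋂ Trop(H_q)`, Section 6. -/
theorem statement_0
    (n r : ℕ) (hn : 3 ≤ n) (hr1 : 1 ≤ r) (hrn : r ≤ n - 3)
    (S : ℕ → Finset (Fin n)) (i j : ℕ → Fin n)
    (hScard : ∀ q, 1 ≤ q → q ≤ r → 3 ≤ (S q).card)
    (hiS : ∀ q, 1 ≤ q → q ≤ r → i q ∈ S q)
    (hjS : ∀ q, 1 ≤ q → q ≤ r → j q ∈ S q)
    (hij : ∀ q, 1 ≤ q → q ≤ r → i q ≠ j q)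
    (B : ℝ) (hB : 2 * (n : ℝ) + 1 ≤ B)
    (Γ : MMTree n) (hpos : Γ.PosLen) (hstab : Γ.toMTree.Stable)
    (hedge : Γ.G.edgeSet.ncard ≤ r)
    (hH : ∀ q, 1 ≤ q → q ≤ r → Γ.CondH (S q) (i q) (j q) (B ^ (n - 3 - q))) :
    -- (1) `T` has exactly `r` edges
    Γ.G.edgeSet.ncard = r ∧
    ∃ e : ℕ → Sym2 Γ.V,
      -- (2) for each `q` there is a unique edge `e_q` with the stated bounds
      (∀ q, 1 ≤ q → q ≤ r →
        e q ∈ Γ.G.edgeSet ∧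
        (1 / 2 : ℝ) * B ^ (n - 3 - q) ≤ Γ.len (e q) ∧
        Γ.len (e q) ≤ (n : ℝ) * B ^ (n - 3 - q) ∧
        ∀ e' ∈ Γ.G.edgeSet,
          (1 / 2 : ℝ) * B ^ (n - 3 - q) ≤ Γ.len e' →
          Γ.len e' ≤ (n : ℝ) * B ^ (n - 3 - q) → e' = e q) ∧
      -- the edges are pairwise distinct and of strictly decreasing lengths
      (∀ q q', 1 ≤ q → q < q' → q' ≤ r →
        e q ≠ e q' ∧ Γ.len (e q') < Γ.len (e q)) ∧
      -- (3) for every minimizing pair `k < l`, `e_q` lies on both paths while no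
      -- earlier `e_{q'}` does
      (∀ q, 1 ≤ q → q ≤ r → ∀ k l : Fin n, k < l →
        Γ.Minimizes (S q) (i q) (j q) (B ^ (n - 3 - q)) k →
        Γ.Minimizes (S q) (i q) (j q) (B ^ (n - 3 - q)) l →
        e q ∈ Γ.toMTree.PathSet (i q) (j q) k l ∧
        ∀ q', 1 ≤ q' → q' < q → e q' ∉ Γ.toMTree.PathSet (i q) (j q) k l) ∧
      -- (4) the minimum in `(H_q)` is attained for exactly two values of `α`
      (∀ q, 1 ≤ q → q ≤ r → ∃ α β : Fin n, α ≠ β ∧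
        Γ.Minimizes (S q) (i q) (j q) (B ^ (n - 3 - q)) α ∧
        Γ.Minimizes (S q) (i q) (j q) (B ^ (n - 3 - q)) β ∧
        ∀ γ : Fin n, Γ.Minimizes (S q) (i q) (j q) (B ^ (n - 3 - q)) γ →
          γ = α ∨ γ = β) := by
  have hB0 : 0 < B := by
    have : (0 : ℝ) ≤ n := n.cast_nonneg
    linarith
  set c : ℕ → ℝ := fun q => B ^ (n - 3 - q) with hc_def
  have hc : ∀ q, 0 < c q := fun q => pow_pos hB0 _
  have hstep : ∀ q, 1 ≤ q → q < r → (2 * (n : ℝ) + 1) * c (q + 1) ≤ c q := by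
    intro q _ hq
    have : c q = B * c (q + 1) := by
      simp only [hc_def]
      rw [← pow_succ']
      congr 1
      lia
    rw [this]
    exact mul_le_mul_of_nonneg_right hB (hc _).le
  have hscale : ∀ q q', 1 ≤ q → q < q' → q' ≤ r → (n : ℝ) * c q' < 1 / 2 * c q := by
    intro q q' h1 h2 h3
    have e1 := sum_Ioc_mul_add_le hstep h1 h2.le h3
    have e2 : c q' ≤ ∑ x ∈ Finset.Ioc q q', c x :=
      Finset.single_le_sum (fun x _ => (hc x).le) (Finset.mem_Ioc.2 ⟨h2, le_rfl⟩)
    have e3 := mul_le_mul_of_nonneg_left e2 (n.cast_nonneg : (0 : ℝ) ≤ n)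
    linarith [hc q']
  set E : Finset (Sym2 Γ.V) := Finset.univ.filter (· ∈ Γ.G.edgeSet) with hE_def
  have hEcard : Γ.G.edgeSet.ncard = E.card := by
    rw [← Set.ncard_coe_finset]
    congr 1
    ext x
    simp [hE_def]
  have hscales : ∀ e ∈ Γ.G.edgeSet, ∀ q q', 1 ≤ q → q ≤ r → 1 ≤ q' → q' ≤ r →
      1 / 2 * c q ≤ Γ.len e → Γ.len e ≤ n * c q → 1 / 2 * c q' ≤ Γ.len e →
      Γ.len e ≤ n * c q' → q = q' := by
    intro e _ q q' h1 h2 h1' h2' a1 a2 a3 a4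
    rcases lt_trichotomy q q' with h | h | h
    · linarith [hscale q q' h1 h h2']
    · exact h
    · linarith [hscale q' q h1' h h2]
  have key : ∀ k l : ℕ → Fin n,
      (∀ q, 1 ≤ q → q ≤ r → k q < l q ∧ Γ.Minimizes (S q) (i q) (j q) (c q) (k q) ∧
        Γ.Minimizes (S q) (i q) (j q) (c q) (l q)) →
      E.card = r ∧ ∃ e : ℕ → Sym2 Γ.V,
        (∀ q, 1 ≤ q → q ≤ r → e q ∈ Γ.toMTree.PathSet (i q) (j q) (k q) (l q) ∧
          1 / 2 * c q ≤ Γ.len (e q) ∧ Γ.len (e q) ≤ n * c q ∧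
          ∀ q', 1 ≤ q' → q' < q → e q' ∉ Γ.toMTree.PathSet (i q) (j q) (k q) (l q)) ∧
        ∀ x ∈ E, ∃ q, 1 ≤ q ∧ q ≤ r ∧ x = e q := by
    intro k l hkl
    have hsum : ∀ q, 1 ≤ q → q ≤ r →
        ∑ e with e ∈ Γ.toMTree.PathSet (i q) (j q) (k q) (l q), Γ.len e =
          (((l q : Fin n) : ℕ) - ((k q : Fin n) : ℕ) : ℝ) * c q := fun q h1 h2 =>
      Γ.sum_pathSet_eq_of_minimizes hpos (hc q) (hkl q h1 h2).1 (hkl q h1 h2).2.1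
        (hkl q h1 h2).2.2
    have := exists_scale_representatives (E := E) (len := Γ.len) (n := n) hr1 hc hstep
      (fun e he => hpos e (Finset.mem_filter.1 he).2) (hEcard ▸ hedge)
      (P := fun q => Finset.univ.filter (· ∈ Γ.toMTree.PathSet (i q) (j q) (k q) (l q)))
      (fun q _ _ e he => Finset.mem_filter.2 ⟨Finset.mem_univ e,
        SimpleGraph.Walk.edges_subset_edgeSet _ (Finset.mem_filter.1 he).2.1⟩)
      (fun q h1 h2 => by
        rw [hsum q h1 h2]
        have : ((k q : ℕ) : ℝ) + 1 ≤ ((l q : ℕ) : ℝ) := by exact_mod_cast (hkl q h1 h2).1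
        nlinarith [hc q])
      (fun q h1 h2 => by
        rw [hsum q h1 h2]
        have h3 : ((l q : ℕ) : ℝ) ≤ n := by exact_mod_cast (l q).2.le
        have h4 : (0 : ℝ) ≤ ((k q : ℕ) : ℝ) := Nat.cast_nonneg _
        exact mul_le_mul_of_nonneg_right (by linarith) (hc q).le)
    simpa only [Finset.mem_filter, Finset.mem_univ, true_and] using this
  have hpairs : ∀ q, ∃ k l : Fin n, 1 ≤ q → q ≤ r → k < l ∧
      Γ.Minimizes (S q) (i q) (j q) (c q) k ∧ Γ.Minimizes (S q) (i q) (j q) (c q) l := by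
    intro q
    by_cases hq : 1 ≤ q ∧ q ≤ r
    · obtain ⟨a, b, hab, ha, hb⟩ := hH q hq.1 hq.2
      rcases lt_or_gt_of_ne hab with h | h
      · exact ⟨a, b, fun _ _ => ⟨h, ha, hb⟩⟩
      · exact ⟨b, a, fun _ _ => ⟨h, hb, ha⟩⟩
    · exact ⟨i q, i q, fun h1 h2 => absurd ⟨h1, h2⟩ hq⟩
  choose k l hkl using hpairs
  obtain ⟨hcard, e, he, hcover⟩ := key k l hkl
  have hmem : ∀ q, 1 ≤ q → q ≤ r → e q ∈ Γ.G.edgeSet := fun q h1 h2 =>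
    SimpleGraph.Walk.edges_subset_edgeSet _ (he q h1 h2).1.1
  have huniq : ∀ q, 1 ≤ q → q ≤ r → ∀ e' ∈ Γ.G.edgeSet, 1 / 2 * c q ≤ Γ.len e' →
      Γ.len e' ≤ n * c q → e' = e q := by
    intro q h1 h2 e' he' a1 a2
    obtain ⟨q', h1', h2', rfl⟩ := hcover e' (by simpa [hE_def] using he')
    rw [hscales _ he' q q' h1 h2 h1' h2' a1 a2 (he q' h1' h2').2.1 (he q' h1' h2').2.2.1]
  have hpath : ∀ q, 1 ≤ q → q ≤ r → ∀ a b : Fin n, a < b →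
      Γ.Minimizes (S q) (i q) (j q) (c q) a → Γ.Minimizes (S q) (i q) (j q) (c q) b →
      e q ∈ Γ.toMTree.PathSet (i q) (j q) a b ∧
        ∀ q', 1 ≤ q' → q' < q → e q' ∉ Γ.toMTree.PathSet (i q) (j q) a b := by
    intro q h1 h2 a b hab ha hb
    obtain ⟨-, e', he', -⟩ := key (Function.update k q a) (Function.update l q b) (by
      intro p hp1 hp2
      rcases eq_or_ne p q with rfl | hpq
      · simpa using ⟨hab, ha, hb⟩
      · simpa [hpq] using hkl p hp1 hp2)
    have hee' : ∀ p, 1 ≤ p → p ≤ r → e' p = e p := fun p hp1 hp2 =>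
      huniq p hp1 hp2 _ (SimpleGraph.Walk.edges_subset_edgeSet _ (he' p hp1 hp2).1.1)
        (he' p hp1 hp2).2.1 (he' p hp1 hp2).2.2.1
    obtain ⟨b1, -, -, b4⟩ := he' q h1 h2
    simp only [Function.update_self, hee' q h1 h2] at b1 b4
    exact ⟨b1, fun q' h1' h2' => hee' q' h1' (by lia) ▸ b4 q' h1' h2'⟩
  refine ⟨hEcard.trans hcard, e, fun q h1 h2 => ⟨hmem q h1 h2, (he q h1 h2).2.1,
    (he q h1 h2).2.2.1, huniq q h1 h2⟩, fun q q' h1 h2 h3 => ?_, hpath, fun q h1 h2 => ?_⟩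
  · have hlt : Γ.len (e q') < Γ.len (e q) :=
      ((he q' (by lia) h3).2.2.1.trans_lt (hscale q q' h1 h2 h3)).trans_le
        (he q h1 (by lia)).2.1
    exact ⟨fun h => hlt.ne (by rw [h]), hlt⟩
  · obtain ⟨a, b, hab, ha, hb⟩ := hH q h1 h2
    have hne : ∀ x y : Fin n, x ≠ y → Γ.Minimizes (S q) (i q) (j q) (c q) x →
        Γ.Minimizes (S q) (i q) (j q) (c q) y → e q ∈ Γ.toMTree.PathSet (i q) (j q) x y := by
      intro x y hxy hx hy
      rcases lt_or_gt_of_ne hxy with h | h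
      · exact (hpath q h1 h2 x y h hx hy).1
      · rw [Γ.pathSet_comm]
        exact (hpath q h1 h2 y x h hy hx).1
    refine ⟨a, b, hab, ha, hb, fun x hx => ?_⟩
    by_contra! hno
    exact Γ.notMem_pathSet_of_mem (hne a b hab ha hb) (hne a x hno.1.symm ha hx)
      (hne b x hno.2.symm hb hx)

end TropPsi
end

section
/- Assume the setup. Let (T, m) be a stable [n]-marked tree with at most r edges, and let λ₁, λ₂ : E(T) → ℝ be two length functions, positive on every edge, such that both metric trees (T, m, λ₁) and (T, m, λ₂) satisfy condition (H_q) for every q ∈ {1,…,r}. Then λ₁ = λ₂. (Equivalently: distinct elements of Σ_r ∩ ⋂_{q=1}^r Trop(H_q) have distinct underlying marked trees. Paper: Proposition on injectivity of the underlying-tree map on the firework set, Section 8.) -/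
open scoped Classical

namespace TropPsi

namespace MTree

variable {n : ℕ}

theorem isPath_path (τ : MTree n) (u v : τ.V) : (τ.path u v).IsPath :=
  (τ.isTree.existsUnique_path u v).exists.choose_spec

/-- An edge avoided by some walk is avoided by the path. -/
theorem not_onPath_of_walk (τ : MTree n) {u v : τ.V} {e : Sym2 τ.V} (w : τ.G.Walk u v)
    (hw : e ∉ w.edges) : ¬ τ.onPath u v e := by
  have h : τ.path u v = w.bypass :=
    (τ.isTree.existsUnique_path u v).unique (τ.isPath_path u v) w.bypass_isPath
  unfold onPath
  rw [h]
  exact fun h' => hw (w.edges_bypass_subset_edges h')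

theorem onPath_comm (τ : MTree n) {u v : τ.V} {e : Sym2 τ.V} :
    τ.onPath u v e ↔ τ.onPath v u e := by
  have key : ∀ u v : τ.V, ¬ τ.onPath u v e → ¬ τ.onPath v u e := fun u v h =>
    τ.not_onPath_of_walk (τ.path u v).reverse (by simpa [onPath] using h)
  exact ⟨fun h => by_contra fun h' => key _ _ h' h, fun h => by_contra fun h' => key _ _ h' h⟩

theorem not_onPath_trans (τ : MTree n) {u v w : τ.V} {e : Sym2 τ.V}
    (huv : ¬ τ.onPath u v e) (hvw : ¬ τ.onPath v w e) : ¬ τ.onPath u w e :=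
  τ.not_onPath_of_walk ((τ.path u v).append (τ.path v w)) (by
    simp only [SimpleGraph.Walk.edges_append, List.mem_append, not_or]
    exact ⟨huv, hvw⟩)

/-- Every vertex lies on the side of one of the two ends of an edge. -/
theorem not_onPath_or_of_walk (τ : MTree n) (a b : τ.V) {v w : τ.V} (p : τ.G.Walk v w)
    (hw : w = a ∨ w = b) : ¬ τ.onPath v a s(a, b) ∨ ¬ τ.onPath v b s(a, b) := by
  have hrefl : ∀ x y : τ.V, x = y → ¬ τ.onPath x y s(a, b) := by
    rintro x _ rfl
    exact τ.not_onPath_of_walk .nil (by simp)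
  induction p with
  | nil => exact hw.imp (hrefl _ _) (hrefl _ _)
  | @cons x y z hxy p ih =>
    by_cases hE : s(a, b) = s(x, y)
    · rcases Sym2.eq_iff.1 hE with ⟨h, -⟩ | ⟨-, h⟩
      · exact .inl (hrefl _ _ h.symm)
      · exact .inr (hrefl _ _ h.symm)
    · have hx : ¬ τ.onPath x y s(a, b) :=
        τ.not_onPath_of_walk (.cons hxy .nil) (by simpa using hE)
      exact (ih hw).imp (τ.not_onPath_trans hx) (τ.not_onPath_trans hx)

/-- An edge separates the vertices into at most two classes. -/
theorem not_onPath_of_onPath (τ : MTree n) {u v w : τ.V} {e : Sym2 τ.V}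
    (huv : τ.onPath u v e) (huw : τ.onPath u w e) : ¬ τ.onPath v w e := by
  induction e with
  | _ a b =>
    have side := fun x : τ.V => τ.not_onPath_or_of_walk a b (τ.path x a) (.inl rfl)
    have glue : ∀ {x y z : τ.V}, ¬ τ.onPath x z s(a, b) → ¬ τ.onPath y z s(a, b) →
        ¬ τ.onPath x y s(a, b) := fun hx hy =>
      τ.not_onPath_trans hx (fun h => hy (τ.onPath_comm.1 h))
    rcases side u with hu | hu <;> rcases side v with hv | hv <;> rcases side w with hw | hw <;>
      first
        | exact absurd huv (glue hu hv)
        | exact absurd huw (glue hu hw)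
        | exact glue hv hw

theorem onPath_iff_xor (τ : MTree n) (u v w : τ.V) (e : Sym2 τ.V) :
    τ.onPath v w e ↔ (τ.onPath u v e ∧ ¬ τ.onPath u w e ∨ τ.onPath u w e ∧ ¬ τ.onPath u v e) := by
  have h₁ := @not_onPath_of_onPath n τ u v w e
  have h₂ := @not_onPath_trans n τ v u w e
  have h₃ := @not_onPath_trans n τ u v w e
  have h₄ := @not_onPath_trans n τ u w v e
  rw [τ.onPath_comm (u := v) (v := u)] at h₂
  rw [τ.onPath_comm (u := w) (v := v)] at h₄
  tauto

/-- The ends of an edge on a path avoiding `e` are on the same side of `e` as the path. -/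
theorem not_onPath_of_mem (τ : MTree n) {u v c : τ.V} {e e' : Sym2 τ.V}
    (he : ¬ τ.onPath u v e) (he' : τ.onPath u v e') (hc : c ∈ e') : ¬ τ.onPath u c e := by
  have hmem : c ∈ (τ.path u v).support := SimpleGraph.Walk.mem_support_of_mem_edges he' hc
  exact τ.not_onPath_of_walk ((τ.path u v).takeUntil c hmem)
    (fun h => he ((τ.path u v).edges_takeUntil_subset_edges hmem h))

/-- The edges of the path between two vertices, as a finite set. -/
noncomputable def pathEdges (τ : MTree n) (u v : τ.V) : Finset (Sym2 τ.V) :=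
  (τ.path u v).edges.toFinset

theorem mem_pathEdges (τ : MTree n) {u v : τ.V} {e : Sym2 τ.V} :
    e ∈ τ.pathEdges u v ↔ τ.onPath u v e := by
  simp [pathEdges, onPath]

/-- The edges between the leg `i` and the median of the legs `i`, `j`, `l`. -/
noncomputable def projEdges (τ : MTree n) (i j l : Fin n) : Finset (Sym2 τ.V) :=
  τ.pathEdges (τ.mark i) (τ.mark j) ∩ τ.pathEdges (τ.mark i) (τ.mark l)

theorem mem_edgeSet_of_mem_projEdges (τ : MTree n) {i j l : Fin n} {e : Sym2 τ.V}
    (he : e ∈ τ.projEdges i j l) : e ∈ τ.G.edgeSet :=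
  SimpleGraph.Walk.edges_subset_edgeSet _ (τ.mem_pathEdges.1 (Finset.mem_inter.1 he).1)

theorem projEdges_subset_or_subset (τ : MTree n) (i j k l : Fin n) :
    τ.projEdges i j k ⊆ τ.projEdges i j l ∨ τ.projEdges i j l ⊆ τ.projEdges i j k := by
  by_contra! h
  obtain ⟨e, he, he'⟩ := Finset.not_subset.1 h.1
  obtain ⟨f, hf, hf'⟩ := Finset.not_subset.1 h.2
  simp only [projEdges, Finset.mem_inter, mem_pathEdges, not_and] at he he' hf hf'
  have hil := he' he.1
  have hik := hf' hf.1
  have hjk : ¬ τ.onPath (τ.mark j) (τ.mark k) e := τ.not_onPath_of_onPath he.1 he.2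
  have hfjk : τ.onPath (τ.mark j) (τ.mark k) f :=
    (τ.onPath_iff_xor (τ.mark i) _ _ f).2 (.inl ⟨hf.1, hik⟩)
  obtain ⟨c, hc⟩ : ∃ c, c ∈ f := by
    induction f with
    | _ a b => exact ⟨a, Sym2.mem_mk_left a b⟩
  have h₁ := τ.not_onPath_of_mem hil hf.2 hc
  have h₂ := τ.not_onPath_of_mem hjk hfjk hc
  exact τ.not_onPath_trans h₁ (fun h => h₂ (τ.onPath_comm.1 h)) he.1

theorem legDist_withLen (τ : MTree n) (lam : Sym2 τ.V → ℝ) (i j : Fin n) :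
    (τ.withLen lam).legDist i j = ∑ e ∈ τ.pathEdges (τ.mark i) (τ.mark j), lam e :=
  (List.sum_toFinset lam (τ.isPath_path _ _).isTrail.edges_nodup).symm

theorem proj_withLen (τ : MTree n) (lam : Sym2 τ.V → ℝ) (i j l : Fin n) :
    (τ.withLen lam).proj i j l = ∑ e ∈ τ.projEdges i j l, lam e := by
  set X := τ.pathEdges (τ.mark i) (τ.mark j) with hX
  set Y := τ.pathEdges (τ.mark i) (τ.mark l) with hY
  have hZ : τ.pathEdges (τ.mark j) (τ.mark l) = (X \ Y) ∪ (Y \ X) := by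
    ext e
    simp only [hX, hY, Finset.mem_union, Finset.mem_sdiff, mem_pathEdges]
    exact τ.onPath_iff_xor _ _ _ e
  have hdisj : Disjoint (X \ Y) (Y \ X) := disjoint_sdiff_sdiff
  have h₁ := Finset.sum_inter_add_sum_sdiff X Y lam
  have h₂ := Finset.sum_inter_add_sum_sdiff Y X lam
  rw [Finset.inter_comm] at h₂
  rw [MMTree.proj, legDist_withLen, legDist_withLen, legDist_withLen, hZ,
    Finset.sum_union hdisj, projEdges]
  linarith

end MTree

theorem sum_biUnion_le_sum {κ ι : Type*} [DecidableEq ι] (s : Finset κ) (t : κ → Finset ι)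
    (g : ι → ℝ) (hg : ∀ k, ∀ x ∈ t k, 0 ≤ g x) :
    ∑ x ∈ s.biUnion t, g x ≤ ∑ k ∈ s, ∑ x ∈ t k, g x := by
  induction s using Finset.induction_on with
  | empty => simp
  | insert a s ha ih =>
    rw [Finset.biUnion_insert, Finset.sum_insert ha]
    have h := Finset.sum_union_inter (s₁ := t a) (s₂ := s.biUnion t) (f := g)
    have h' : 0 ≤ ∑ x ∈ t a ∩ s.biUnion t, g x :=
      Finset.sum_nonneg fun x hx => hg a x (Finset.mem_inter.1 hx).1
    linarith

section Chains

variable {n : ℕ} {ι : Type*} [DecidableEq ι]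

/-- The quantity minimized in a chain of edge sets `A`, with weight `c` on the markings. -/
def chainVal (lam : ι → ℝ) (A : Fin n → Finset ι) (c : ℝ) (γ : Fin n) : ℝ :=
  ∑ e ∈ A γ, lam e + (((γ : ℕ) : ℝ) + 1) * c

/-- `α` minimizes `chainVal` over `L`. -/
def ChainMin (lam : ι → ℝ) (L : Finset (Fin n)) (A : Fin n → Finset ι) (c : ℝ) (α : Fin n) :
    Prop :=
  α ∈ L ∧ ∀ γ ∈ L, chainVal lam A c α ≤ chainVal lam A c γ

theorem exists_ordered_minimizers {lam : ι → ℝ} {L : Finset (Fin n)} {A : Fin n → Finset ι} {c : ℝ}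
    (hc : 0 < c) (hchain : ∀ a b, A a ⊆ A b ∨ A b ⊆ A a) (hpos : ∀ γ, ∀ e ∈ A γ, 0 < lam e)
    {f : Fin n} (hfL : f ∈ L) (hf : ∀ γ ∈ L, A f ⊆ A γ)
    (H : ∃ α β, α ≠ β ∧ ChainMin lam L A c α ∧ ChainMin lam L A c β) :
    ∃ α β, ChainMin lam L A c α ∧ ChainMin lam L A c β ∧ A α ⊆ A β ∧
      c ≤ ∑ e ∈ A β \ A α, lam e ∧ ∑ e ∈ A β \ A f, lam e ≤ ((n : ℝ) - 1) * c := by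
  obtain ⟨α, β, hne, hα, hβ, hsub⟩ :
      ∃ α β, α ≠ β ∧ ChainMin lam L A c α ∧ ChainMin lam L A c β ∧ A α ⊆ A β := by
    obtain ⟨α, β, hne, hα, hβ⟩ := H
    rcases hchain α β with h | h
    exacts [⟨α, β, hne, hα, hβ, h⟩, ⟨β, α, hne.symm, hβ, hα, h⟩]
  have hαβ := hα.2 β hβ.1
  have hβα := hβ.2 α hα.1
  have hβf := hβ.2 f hfL
  simp only [chainVal] at hαβ hβα hβf
  have h₁ := Finset.sum_sdiff (f := lam) hsub
  have h₂ := Finset.sum_sdiff (f := lam) (hf β hβ.1)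
  have hnonneg : 0 ≤ ∑ e ∈ A β \ A α, lam e :=
    Finset.sum_nonneg fun e he => (hpos β e (Finset.mem_sdiff.1 he).1).le
  refine ⟨α, β, hα, hβ, hsub, ?_, ?_⟩
  · have hle : ((β : ℕ) : ℝ) ≤ (α : ℕ) := by
      by_contra! h
      nlinarith
    have hlt : (β : ℕ) < α :=
      lt_of_le_of_ne (by exact_mod_cast hle) (fun h => hne (Fin.ext h.symm))
    have : ((β : ℕ) : ℝ) + 1 ≤ (α : ℕ) := by exact_mod_cast hlt
    nlinarith
  · have hfn : ((f : ℕ) : ℝ) + 1 ≤ n := by exact_mod_cast f.2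
    have hβ0 : (0 : ℝ) ≤ (β : ℕ) := Nat.cast_nonneg _
    nlinarith

/-- When the weights decrease fast, each chain has an edge, between its two minimizers, that no
later chain reaches; these edges enumerate `E`. -/
theorem exists_pivots {r : ℕ} {E : Finset ι} (hE : E.card ≤ r) {lam : ι → ℝ}
    {L : Fin r → Finset (Fin n)} {A : Fin r → Fin n → Finset ι} {c : Fin r → ℝ}
    (hc : ∀ q, 0 < c q) (hdec : ∀ q, ∑ s ∈ Finset.Ioi q, ((n : ℝ) - 1) * c s < c q)
    (hchain : ∀ q a b, A q a ⊆ A q b ∨ A q b ⊆ A q a) (hAE : ∀ q γ, A q γ ⊆ E)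
    (hpos : ∀ e ∈ E, 0 < lam e)
    {f : Fin r → Fin n} (hfL : ∀ q, f q ∈ L q) (hf : ∀ q, ∀ γ ∈ L q, A q (f q) ⊆ A q γ)
    (H : ∀ q, ∃ α β, α ≠ β ∧ ChainMin lam (L q) (A q) (c q) α ∧
      ChainMin lam (L q) (A q) (c q) β) :
    ∃ (e : Fin r → ι) (α β : Fin r → Fin n), Function.Injective e ∧ (∀ x ∈ E, ∃ q, e q = x) ∧
      (∀ q, ChainMin lam (L q) (A q) (c q) (α q)) ∧
      (∀ q, ChainMin lam (L q) (A q) (c q) (β q)) ∧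
      (∀ q, A q (α q) ⊆ A q (β q)) ∧ (∀ q, e q ∈ A q (β q) \ A q (α q)) ∧
      ∀ q s, q < s → e q ∉ A s (β s) \ A s (f s) := by
  choose α β hα hβ hsub hlow hup using fun q =>
    exists_ordered_minimizers (hc q) (hchain q) (fun γ e he => hpos e (hAE q γ he)) (hfL q) (hf q)
      (H q)
  have hex : ∀ q, ∃ e ∈ A q (β q) \ A q (α q), ∀ s, q < s → e ∉ A s (β s) \ A s (f s) := by
    intro q
    by_contra! hcon
    have hcov : A q (β q) \ A q (α q) ⊆
        (Finset.Ioi q).biUnion fun s => A s (β s) \ A s (f s) := by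
      intro e he
      obtain ⟨s, hs, hes⟩ := hcon e he
      exact Finset.mem_biUnion.2 ⟨s, Finset.mem_Ioi.2 hs, hes⟩
    have hnn : ∀ s, ∀ e ∈ A s (β s) \ A s (f s), 0 ≤ lam e := fun s e he =>
      (hpos e (hAE s _ (Finset.mem_sdiff.1 he).1)).le
    have h₁ : ∑ e ∈ A q (β q) \ A q (α q), lam e ≤
        ∑ e ∈ (Finset.Ioi q).biUnion fun s => A s (β s) \ A s (f s), lam e := by
      refine Finset.sum_le_sum_of_subset_of_nonneg hcov fun e he _ => ?_
      obtain ⟨s, -, hes⟩ := Finset.mem_biUnion.1 he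
      exact hnn s e hes
    have h₂ : ∑ e ∈ (Finset.Ioi q).biUnion fun s => A s (β s) \ A s (f s), lam e ≤
        ∑ s ∈ Finset.Ioi q, ∑ e ∈ A s (β s) \ A s (f s), lam e :=
      sum_biUnion_le_sum _ _ _ hnn
    have h₃ := Finset.sum_le_sum fun s (_ : s ∈ Finset.Ioi q) => hup s
    linarith [hlow q, hdec q]
  choose e he hlate using hex
  have hinj : Function.Injective e := by
    have key : ∀ q s, q < s → e q ≠ e s := fun q s hqs h => hlate q s hqs (by
      have hs := Finset.mem_sdiff.1 (he s)
      rw [h]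
      exact Finset.mem_sdiff.2 ⟨hs.1, fun h' => hs.2 (hf s _ (hα s).1 h')⟩)
    intro q s h
    rcases lt_trichotomy q s with hlt | heq | hgt
    exacts [absurd h (key _ _ hlt), heq, absurd h.symm (key _ _ hgt)]
  have himg : Finset.univ.image e = E := by
    refine Finset.eq_of_subset_of_card_le ?_ ?_
    · intro x hx
      obtain ⟨q, -, rfl⟩ := Finset.mem_image.1 hx
      exact hAE q _ (Finset.mem_sdiff.1 (he q)).1
    · rw [Finset.card_image_of_injective _ hinj]
      simpa using hE
  refine ⟨e, α, β, hinj, fun x hx => ?_, hα, hβ, hsub, he, hlate⟩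
  rw [← himg] at hx
  simpa using hx

/-- A fast decreasing system of chain conditions determines the length function. -/
theorem eq_of_chainMin {r : ℕ} {E : Finset ι} (hE : E.card ≤ r) {lam₁ lam₂ : ι → ℝ}
    {L : Fin r → Finset (Fin n)} {A : Fin r → Fin n → Finset ι} {c : Fin r → ℝ}
    (hc : ∀ q, 0 < c q) (hdec : ∀ q, ∑ s ∈ Finset.Ioi q, ((n : ℝ) - 1) * c s < c q)
    (hchain : ∀ q a b, A q a ⊆ A q b ∨ A q b ⊆ A q a) (hAE : ∀ q γ, A q γ ⊆ E)
    (hpos₁ : ∀ e ∈ E, 0 < lam₁ e) (hpos₂ : ∀ e ∈ E, 0 < lam₂ e)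
    (H₁ : ∀ q, ∃ α β, α ≠ β ∧ ChainMin lam₁ (L q) (A q) (c q) α ∧
      ChainMin lam₁ (L q) (A q) (c q) β)
    (H₂ : ∀ q, ∃ α β, α ≠ β ∧ ChainMin lam₂ (L q) (A q) (c q) α ∧
      ChainMin lam₂ (L q) (A q) (c q) β) :
    ∀ e ∈ E, lam₁ e = lam₂ e := by
  have hfirst : ∀ q, ∃ f ∈ L q, ∀ γ ∈ L q, A q f ⊆ A q γ := by
    intro q
    obtain ⟨α, -, -, hα, -⟩ := H₁ q
    obtain ⟨f, hfL, hf⟩ := Finset.exists_min_image (L q) (fun γ => (A q γ).card) ⟨α, hα.1⟩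
    refine ⟨f, hfL, fun γ hγ => (hchain q f γ).elim id fun h => ?_⟩
    exact (Finset.eq_of_subset_of_card_le h (hf γ hγ)).ge
  choose f hfL hf using hfirst
  obtain ⟨e, α, β, hinj, hsurj, hα, hβ, hsub, he, hlate⟩ :=
    exists_pivots hE hc hdec hchain hAE hpos₁ hfL hf H₁
  obtain ⟨e', α', β', hinj', hsurj', hα', hβ', hsub', he', hlate'⟩ :=
    exists_pivots hE hc hdec hchain hAE hpos₂ hfL hf H₂
  have hee : ∀ q, e q = e' q := by
    intro q
    induction q using WellFoundedGT.induction with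
    | _ q ih =>
      have heq := Finset.mem_sdiff.1 (he q)
      have heq' := Finset.mem_sdiff.1 (he' q)
      rcases hchain q (β q) (β' q) with h | h
      · obtain ⟨s, hs⟩ := hsurj' (e q) (hAE q _ heq.1)
        rcases lt_trichotomy s q with hlt | rfl | hgt
        · refine absurd ?_ (hlate' s q hlt)
          rw [hs]
          exact Finset.mem_sdiff.2 ⟨h heq.1, fun h' => heq.2 (hf q _ (hα q).1 h')⟩
        · exact hs.symm
        · rw [← ih s hgt] at hs
          exact absurd (hinj hs) hgt.ne'
      · obtain ⟨s, hs⟩ := hsurj (e' q) (hAE q _ heq'.1)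
        rcases lt_trichotomy s q with hlt | rfl | hgt
        · refine absurd ?_ (hlate s q hlt)
          rw [hs]
          exact Finset.mem_sdiff.2 ⟨h heq'.1, fun h' => heq'.2 (hf q _ (hα' q).1 h')⟩
        · exact hs
        · rw [ih s hgt] at hs
          exact absurd (hinj' hs) hgt.ne'
  obtain rfl : e = e' := funext hee
  have hlen : ∀ q, lam₂ (e q) - lam₁ (e q) = 0 := by
    intro q
    induction q using WellFoundedGT.induction with
    | _ q ih =>
      have hout : ∀ x, (x ∈ A q (β q) \ A q (f q) ∨ x ∈ A q (β' q) \ A q (f q)) → x ≠ e q →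
          lam₂ x - lam₁ x = 0 := by
        intro x hx hne
        obtain ⟨s, rfl⟩ := hsurj x (hx.elim (fun h => hAE q _ (Finset.mem_sdiff.1 h).1)
          (fun h => hAE q _ (Finset.mem_sdiff.1 h).1))
        rcases lt_trichotomy s q with hlt | rfl | hgt
        · exact (hx.elim (hlate s q hlt) (hlate' s q hlt)).elim
        · exact absurd rfl hne
        · exact ih s hgt
      have hval : ∀ γ, chainVal lam₂ (A q) (c q) γ =
          chainVal lam₁ (A q) (c q) γ + ∑ x ∈ A q γ, (lam₂ x - lam₁ x) := by
        intro γ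
        simp only [chainVal, Finset.sum_sub_distrib]
        ring
      have hsplit : ∀ γ ∈ L q, ∑ x ∈ A q γ, (lam₂ x - lam₁ x) =
          ∑ x ∈ A q γ \ A q (f q), (lam₂ x - lam₁ x) +
            ∑ x ∈ A q (f q), (lam₂ x - lam₁ x) := fun γ hγ =>
        (Finset.sum_sdiff (hf q γ hγ)).symm
      have hlow : ∀ γ ∈ L q, (A q γ ⊆ A q (β q) ∨ A q γ ⊆ A q (β' q)) → e q ∉ A q γ →
          ∑ x ∈ A q γ, (lam₂ x - lam₁ x) = ∑ x ∈ A q (f q), (lam₂ x - lam₁ x) := by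
        intro γ hγ hs hn
        rw [hsplit γ hγ, add_eq_right]
        refine Finset.sum_eq_zero fun x hx => hout x ?_ ?_
        · exact hs.imp (fun h => Finset.sdiff_subset_sdiff h le_rfl hx)
            (fun h => Finset.sdiff_subset_sdiff h le_rfl hx)
        · rintro rfl
          exact hn (Finset.mem_sdiff.1 hx).1
      have heq := Finset.mem_sdiff.1 (he q)
      have heq' := Finset.mem_sdiff.1 (he' q)
      have hhigh : ∀ γ ∈ L q, (A q γ ⊆ A q (β q) ∨ A q γ ⊆ A q (β' q)) → e q ∈ A q γ →
          ∑ x ∈ A q γ, (lam₂ x - lam₁ x) =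
            lam₂ (e q) - lam₁ (e q) + ∑ x ∈ A q (f q), (lam₂ x - lam₁ x) := by
        intro γ hγ hs hn
        rw [hsplit γ hγ, Finset.sum_eq_single_of_mem (e q)
          (Finset.mem_sdiff.2 ⟨hn, fun h => heq.2 (hf q _ (hα q).1 h)⟩)]
        exact fun x hx hne => hout x (hs.imp (fun h => Finset.sdiff_subset_sdiff h le_rfl hx)
            (fun h => Finset.sdiff_subset_sdiff h le_rfl hx)) hne
      have vα := hval (α q)
      have vα' := hval (α' q)
      have vβ := hval (β q)
      have vβ' := hval (β' q)
      rw [hlow _ (hα q).1 (.inl (hsub q)) heq.2] at vα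
      rw [hlow _ (hα' q).1 (.inr (hsub' q)) heq'.2] at vα'
      rw [hhigh _ (hβ q).1 (.inl le_rfl) heq.1] at vβ
      rw [hhigh _ (hβ' q).1 (.inr le_rfl) heq'.1] at vβ'
      have m₁ := (hα q).2 _ (hα' q).1
      have m₂ := (hα' q).2 _ (hα q).1
      have m₃ := (hβ q).2 _ (hβ' q).1
      have m₄ := (hβ' q).2 _ (hβ q).1
      have m₅ := (hα q).2 _ (hβ q).1
      have m₆ := (hβ q).2 _ (hα q).1
      have m₇ := (hα' q).2 _ (hβ' q).1
      have m₈ := (hβ' q).2 _ (hα' q).1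
      linarith
  intro x hx
  obtain ⟨q, rfl⟩ := hsurj x hx
  linarith [hlen q]

end Chains

theorem sum_Ioc_pow_lt {n r : ℕ} (hrn : r ≤ n - 3) {B : ℝ} (hB : (n : ℝ) ≤ B) (hB0 : 0 < B)
    {q : ℕ} (hq : q ≤ r) :
    ∑ s ∈ Finset.Ioc q r, ((n : ℝ) - 1) * B ^ (n - 3 - s) < B ^ (n - 3 - q) := by
  induction hq using Nat.decreasingInduction with
  | self => simpa using pow_pos hB0 _
  | of_succ q hq ih =>
    have hpow : B ^ (n - 3 - q) = B ^ (n - 3 - (q + 1)) * B := by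
      rw [← pow_succ]
      congr 1
      omega
    have hIoc : Finset.Ioc q r = insert (q + 1) (Finset.Ioc (q + 1) r) := by
      ext s
      simp only [Finset.mem_Ioc, Finset.mem_insert]
      omega
    rw [hIoc, Finset.sum_insert (by simp), hpow]
    nlinarith [pow_pos hB0 (n - 3 - (q + 1))]

/-- Proposition on injectivity of the underlying-tree map on
the firework set, Section 8. -/
theorem statement_10
    (n r : ℕ) (hn : 3 ≤ n) (hr1 : 1 ≤ r) (hrn : r ≤ n - 3)
    (S : ℕ → Finset (Fin n)) (i j : ℕ → Fin n)
    (hScard : ∀ q, 1 ≤ q → q ≤ r → 3 ≤ (S q).card)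
    (hiS : ∀ q, 1 ≤ q → q ≤ r → i q ∈ S q)
    (hjS : ∀ q, 1 ≤ q → q ≤ r → j q ∈ S q)
    (hij : ∀ q, 1 ≤ q → q ≤ r → i q ≠ j q)
    (B : ℝ) (hB : 2 * (n : ℝ) + 1 ≤ B)
    (τ : MTree n) (hstab : τ.Stable) (hedge : τ.G.edgeSet.ncard ≤ r)
    (lam₁ lam₂ : Sym2 τ.V → ℝ)
    (hpos₁ : (τ.withLen lam₁).PosLen) (hpos₂ : (τ.withLen lam₂).PosLen)
    (hH₁ : ∀ q, 1 ≤ q → q ≤ r →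
      (τ.withLen lam₁).CondH (S q) (i q) (j q) (B ^ (n - 3 - q)))
    (hH₂ : ∀ q, 1 ≤ q → q ≤ r →
      (τ.withLen lam₂).CondH (S q) (i q) (j q) (B ^ (n - 3 - q))) :
    ∀ ed ∈ τ.G.edgeSet, lam₁ ed = lam₂ ed := by
  have hB0 : 0 < B := by linarith [Nat.cast_nonneg (α := ℝ) n]
  have hBn : (n : ℝ) ≤ B := by linarith [Nat.cast_nonneg (α := ℝ) n]
  have hval : ∀ (lam : Sym2 τ.V → ℝ) (a b : Fin n) (c : ℝ) (γ : Fin n),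
      (τ.withLen lam).hval a b c γ = chainVal lam (τ.projEdges a b) c γ := by
    intro lam a b c γ
    rw [MMTree.hval, τ.proj_withLen, chainVal]
  have hcond : ∀ (lam : Sym2 τ.V → ℝ) (T : Finset (Fin n)) (a b : Fin n) (c : ℝ),
      (τ.withLen lam).CondH T a b c → ∃ α β, α ≠ β ∧
        ChainMin lam (T \ {a, b}) (τ.projEdges a b) c α ∧
        ChainMin lam (T \ {a, b}) (τ.projEdges a b) c β := by
    intro lam T a b c h
    simpa only [MMTree.CondH, MMTree.Minimizes, hval, ChainMin] using h
  have key := eq_of_chainMin (E := τ.G.edgeSet.toFinset) (lam₁ := lam₁) (lam₂ := lam₂) (r := r)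
    (L := fun q => S (q + 1) \ {i (q + 1), j (q + 1)})
    (A := fun q => τ.projEdges (i (q + 1)) (j (q + 1)))
    (c := fun q => B ^ (n - 3 - ((q : ℕ) + 1)))
    (by rwa [← Set.ncard_eq_toFinset_card']) (fun q => pow_pos hB0 _)
    (fun q => ?_) (fun q a b => τ.projEdges_subset_or_subset _ _ a b)
    (fun q γ e he => Set.mem_toFinset.2 (τ.mem_edgeSet_of_mem_projEdges he))
    (fun e he => hpos₁ e (Set.mem_toFinset.1 he)) (fun e he => hpos₂ e (Set.mem_toFinset.1 he))
    (fun q => hcond _ _ _ _ _ (hH₁ (q + 1) (by omega) (by omega)))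
    (fun q => hcond _ _ _ _ _ (hH₂ (q + 1) (by omega) (by omega)))
  · exact fun ed hed => key ed (Set.mem_toFinset.2 hed)
  · refine lt_of_eq_of_lt ?_ (sum_Ioc_pow_lt hrn hBn hB0 (q := (q : ℕ) + 1) (by omega))
    refine Finset.sum_bij (fun s _ => (s : ℕ) + 1) ?_ ?_ ?_ (fun _ _ => rfl)
    · intro s hs
      have := Fin.lt_def.1 (Finset.mem_Ioi.1 hs)
      simp only [Finset.mem_Ioc]
      omega
    · intro s _ t _ h
      exact Fin.ext (by omega)
    · intro s hs
      rw [Finset.mem_Ioc] at hs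
      exact ⟨⟨s - 1, by omega⟩, Finset.mem_Ioi.2 (Fin.lt_def.2 (by simp only; omega)),
        by simp only; omega⟩

end TropPsi
end

section
/- Fix an integer n ≥ 3, a stable [n]-marked tree τ = (T, m), a subset S ⊆ {1,…,n} with |S| ≥ 3, distinct elements i, j ∈ S, and pairwise distinct real numbers (a_ℓ)_{ℓ ∈ S∖{i,j}}. For λ ∈ ℝ^{E(T)} let d_λ(α,β) be the sum of λ(e) over the edges of the path between m(α) and m(β), and let d^{(i,j)}_ℓ(λ) := (1/2)·(d_λ(i,ℓ) + d_λ(i,j) − d_λ(j,ℓ)), a linear function of λ. Let s ≥ 1 and let ℓ_1, …, ℓ_s ∈ S∖{i,j} be pairwise distinct. Suppose there exists λ₀ ∈ ℝ^{E(T)} with λ₀(e) > 0 for all edges e such that d^{(i,j)}_{ℓ_1}(λ₀) + a_{ℓ_1} = ⋯ = d^{(i,j)}_{ℓ_s}(λ₀) + a_{ℓ_s}, and this common value equals the minimum over all ℓ ∈ S∖{i,j} of d^{(i,j)}_ℓ(λ₀) + a_ℓ. Then the s−1 linear functionals λ ↦ d^{(i,j)}_{ℓ_t}(λ) − d^{(i,j)}_{ℓ_1}(λ)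 (t = 2,…,s) on ℝ^{E(T)} are linearly independent; consequently the set {λ ∈ ℝ^{E(T)} : d^{(i,j)}_{ℓ_t}(λ) + a_{ℓ_t} = d^{(i,j)}_{ℓ_1}(λ) + a_{ℓ_1} for all t = 2,…,s} is an affine subspace of ℝ^{E(T)} of codimension exactly s−1. (Paper: Lemma that on every cone of M_{0,n}^trop, the locus where the minimum is achieved s times has codimension s−1, Section 5.) -/
open scoped Classical

namespace TropPsi

/-- The distance between two vertices as a (linear) function of a vector of
edge lengths `lam : E(T) → ℝ`. -/
noncomputable def edist {n : ℕ} (τ : MTree n) (lam : ↥τ.G.edgeSet → ℝ)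
    (u v : τ.V) : ℝ :=
  ((τ.path u v).edges.map
    (fun ed => if h : ed ∈ τ.G.edgeSet then lam ⟨ed, h⟩ else 0)).sum

/-- The projection coordinate `d_l^{(i,j)}` as a function of an edge-length
vector `lam : E(T) → ℝ`. -/
noncomputable def eproj {n : ℕ} (τ : MTree n) (lam : ↥τ.G.edgeSet → ℝ)
    (i j l : Fin n) : ℝ :=
  (edist τ lam (τ.mark i) (τ.mark l) + edist τ lam (τ.mark i) (τ.mark j) -
    edist τ lam (τ.mark j) (τ.mark l)) / 2

/-- A function on the values of a map that is injective along a list can be prescribed freely. -/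
theorem exists_comp_eq_of_nodup_map {α β γ : Type*} [Inhabited γ] (f : α → β) (l : List α)
    (hl : (l.map f).Nodup) (φ : α → γ) : ∃ g : β → γ, ∀ d ∈ l, g (f d) = φ d := by
  refine ⟨fun e => if h : ∃ d ∈ l, f d = e then φ h.choose else default, fun d hd => ?_⟩
  have h : ∃ d' ∈ l, f d' = f d := ⟨d, hd, rfl⟩
  simp only [dif_pos h]
  rw [List.inj_on_of_nodup_map hl h.choose_spec.1 hd h.choose_spec.2]

section Walk

variable {V : Type*} {G : SimpleGraph V}

/-- If the weight of each edge of a walk is the increment of a potential, the total weight is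
the difference of the potential at the two ends. -/
theorem sum_edges_map_eq_sub (g : Sym2 V → ℝ) (h : V → ℝ) {u v : V} (p : G.Walk u v)
    (hp : ∀ d ∈ p.darts, g d.edge = h d.snd - h d.fst) : (p.edges.map g).sum = h v - h u := by
  induction p with
  | nil => simp
  | cons hadj p ih =>
    simp only [SimpleGraph.Walk.darts_cons, List.mem_cons, forall_eq_or_imp] at hp
    have h1 := hp.1
    simp only [SimpleGraph.Dart.edge_mk] at h1
    rw [SimpleGraph.Walk.edges_cons, List.map_cons, List.sum_cons, ih hp.2, h1]
    ring

/-- A walk ending in a set `A` contains a path to a point of `A` that is otherwise disjoint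
from `A`. -/
theorem exists_isPath_first_mem (A : Set V) {u v : V} (p : G.Walk u v) (hv : v ∈ A) :
    ∃ x ∈ A, ∃ q : G.Walk u x, q.IsPath ∧ ∀ y ∈ q.support, y ∈ A → y = x := by
  suffices ∃ x ∈ A, ∃ q : G.Walk u x, ∀ y ∈ q.support, y ∈ A → y = x by
    obtain ⟨x, hx, q, hq⟩ := this
    exact ⟨x, hx, q.bypass, q.bypass_isPath,
      fun y hy => hq y (q.support_bypass_subset_support hy)⟩
  induction p with
  | nil => exact ⟨_, hv, .nil, by simp⟩
  | @cons u w v hadj p ih =>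
    by_cases hu : u ∈ A
    · exact ⟨u, hu, .nil, by simp⟩
    · obtain ⟨x, hx, q, hq⟩ := ih hv
      refine ⟨x, hx, .cons hadj q, fun y hy hyA => ?_⟩
      rw [SimpleGraph.Walk.support_cons, List.mem_cons] at hy
      rcases hy with rfl | hy
      · exact absurd hyA hu
      · exact hq y hy hyA

/-- Two paths that meet only at their common endpoint concatenate to a path. -/
theorem isPath_append_of_forall_mem {u v w : V} {p : G.Walk u v} {q : G.Walk v w}
    (hp : p.IsPath) (hq : q.IsPath) (h : ∀ y ∈ p.support, y ∈ q.support → y = v) :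
    (p.append q).IsPath := by
  rw [SimpleGraph.Walk.isPath_def] at hp hq ⊢
  rw [SimpleGraph.Walk.support_append, List.nodup_append']
  rw [← SimpleGraph.Walk.cons_tail_support, List.nodup_cons] at hq
  refine ⟨hp, hq.2, fun y hy hy' => ?_⟩
  have := h y hy (List.mem_of_mem_tail hy')
  subst this
  exact hq.1 hy'

end Walk

section MTree

variable {n : ℕ} (τ : MTree n)

theorem MTree.path_isPath_s11 (u v : τ.V) : (τ.path u v).IsPath :=
  (τ.isTree.existsUnique_path u v).exists.choose_spec

theorem MTree.path_eq {u v : τ.V} {p : τ.G.Walk u v} (hp : p.IsPath) : τ.path u v = p :=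
  (τ.isTree.existsUnique_path u v).unique (τ.path_isPath_s11 u v) hp

theorem edist_symm (lam : ↥τ.G.edgeSet → ℝ) (u v : τ.V) : edist τ lam u v = edist τ lam v u := by
  unfold edist
  rw [τ.path_eq (τ.path_isPath_s11 v u).reverse, SimpleGraph.Walk.edges_reverse, List.map_reverse,
    List.sum_reverse]

theorem edist_add_of_isPath_append (lam : ↥τ.G.edgeSet → ℝ) {u v w : τ.V} {p : τ.G.Walk u v}
    {q : τ.G.Walk v w} (h : (p.append q).IsPath) :
    edist τ lam u w = edist τ lam u v + edist τ lam v w := by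
  unfold edist
  rw [τ.path_eq h, τ.path_eq h.of_append_left, τ.path_eq h.of_append_right,
    SimpleGraph.Walk.edges_append, List.map_append, List.sum_append]

theorem edist_add (x y : ↥τ.G.edgeSet → ℝ) (u v : τ.V) :
    edist τ (x + y) u v = edist τ x u v + edist τ y u v := by
  unfold edist
  rw [← List.sum_map_add]
  congr 2
  funext e
  split_ifs <;> simp

theorem edist_smul (r : ℝ) (x : ↥τ.G.edgeSet → ℝ) (u v : τ.V) :
    edist τ (r • x) u v = r * edist τ x u v := by
  unfold edist
  rw [← List.sum_map_mul_left]
  congr 2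
  funext e
  split_ifs <;> simp

/-- The projection coordinate as a linear functional of the edge lengths. -/
noncomputable def eprojLinear (i j l : Fin n) : (↥τ.G.edgeSet → ℝ) →ₗ[ℝ] ℝ where
  toFun lam := eproj τ lam i j l
  map_add' x y := by simp only [eproj, edist_add]; ring
  map_smul' r x := by simp only [eproj, edist_smul, smul_eq_mul, RingHom.id_apply]; ring

@[simp]
theorem eprojLinear_apply (i j l : Fin n) (lam : ↥τ.G.edgeSet → ℝ) :
    eprojLinear τ i j l lam = eproj τ lam i j l := rfl

/-- The projection coordinate is the distance from leg `i` to a vertex on the path from `i`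
to `j`. -/
theorem exists_eproj_eq_edist (i j l : Fin n) :
    ∃ x ∈ (τ.path (τ.mark i) (τ.mark j)).support,
      ∀ lam, eproj τ lam i j l = edist τ lam (τ.mark i) x := by
  obtain ⟨x, hx, r, hr, hrx⟩ := exists_isPath_first_mem
    {y | y ∈ (τ.path (τ.mark i) (τ.mark j)).support} (τ.path (τ.mark l) (τ.mark i))
    (SimpleGraph.Walk.start_mem_support _)
  refine ⟨x, hx, fun lam => ?_⟩
  obtain ⟨p, q, hpq⟩ := SimpleGraph.Walk.mem_support_iff_exists_append.1 hx
  have hP : (p.append q).IsPath := hpq ▸ τ.path_isPath_s11 _ _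
  have hmem : ∀ y, y ∈ p.support ∨ y ∈ q.support → y ∈ r.support → y = x := fun y hy hyr =>
    hrx y hyr (by rw [Set.mem_ofPred_eq, hpq, SimpleGraph.Walk.mem_support_append_iff]; exact hy)
  have hil : (p.append r.reverse).IsPath :=
    isPath_append_of_forall_mem hP.of_append_left hr.reverse
      fun y hy hyr => hmem y (.inl hy) (by simpa using hyr)
  have hjl : (q.reverse.append r.reverse).IsPath :=
    isPath_append_of_forall_mem hP.of_append_right.reverse hr.reverse
      fun y hy hyr => hmem y (.inr (by simpa using hy)) (by simpa using hyr)
  rw [eproj, edist_add_of_isPath_append τ lam hP, edist_add_of_isPath_append τ lam hil,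
    edist_add_of_isPath_append τ lam hjl, edist_symm τ lam (τ.mark j) x]
  ring

/-- Edge lengths may be chosen so that the distances from the start of a path to its vertices
are the increments of an arbitrary potential. -/
theorem exists_edist_eq_sub (u v : τ.V) (h : τ.V → ℝ) :
    ∃ lam, ∀ x ∈ (τ.path u v).support, edist τ lam u x = h x - h u := by
  obtain ⟨g, hg⟩ := exists_comp_eq_of_nodup_map SimpleGraph.Dart.edge (τ.path u v).darts
    (τ.path_isPath_s11 u v).isTrail.edges_nodup (fun d => h d.snd - h d.fst)
  refine ⟨fun e => g e, fun x hx => ?_⟩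
  obtain ⟨p, q, hpq⟩ := SimpleGraph.Walk.mem_support_iff_exists_append.1 hx
  have hP : (p.append q).IsPath := hpq ▸ τ.path_isPath_s11 _ _
  rw [← sum_edges_map_eq_sub g h p fun d hd => hg d (by
    rw [hpq, SimpleGraph.Walk.darts_append]; exact List.mem_append_left _ hd), edist,
    τ.path_eq hP.of_append_left]
  congr 1
  refine List.map_congr_left fun e he => ?_
  rw [dif_pos (p.edges_subset_edgeSet he)]

/-- Differences of projection coordinates that take distinct values at some point admit a dual
family of edge-length vectors. -/
theorem exists_eproj_sub_eq_ite (i j : Fin n) {ι : Type*} (l : ι → Fin n) (o : ι)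
    (lam₀ : ↥τ.G.edgeSet → ℝ)
    (hinj : ∀ t t', t ≠ t' → eproj τ lam₀ i j (l t) ≠ eproj τ lam₀ i j (l t')) (t : ι)
    (ht : t ≠ o) :
    ∃ lam, ∀ t', eproj τ lam i j (l t') - eproj τ lam i j (l o) = if t' = t then 1 else 0 := by
  choose x hx hxe using exists_eproj_eq_edist τ i j
  obtain ⟨lam, hlam⟩ := exists_edist_eq_sub τ (τ.mark i) (τ.mark j)
    (fun y => if y = x (l t) then 1 else 0)
  have hne : ∀ t', x (l t') = x (l t) ↔ t' = t := by
    refine fun t' => ⟨fun h => ?_, fun h => h ▸ rfl⟩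
    by_contra hc
    exact hinj t' t hc (by rw [hxe, hxe, h])
  refine ⟨lam, fun t' => ?_⟩
  rw [hxe, hxe, hlam _ (hx _), hlam _ (hx _)]
  simp [hne, ht.symm]

end MTree

/-- Lemma that on every cone of `M_{0,n}^trop` the locus
where the minimum is achieved `s` times has codimension `s − 1`, Section 5. -/
theorem statement_11
    (n : ℕ) (hn : 3 ≤ n) (τ : MTree n) (hstab : τ.Stable)
    (S : Finset (Fin n)) (hS : 3 ≤ S.card)
    (i j : Fin n) (hi : i ∈ S) (hj : j ∈ S) (hij : i ≠ j)
    (a : Fin n → ℝ)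
    (ha : ∀ x ∈ S \ {i, j}, ∀ y ∈ S \ {i, j}, x ≠ y → a x ≠ a y)
    (s : ℕ) (hs : 1 ≤ s)
    (ℓ : ℕ → Fin n)
    (hmem : ∀ t, 1 ≤ t → t ≤ s → ℓ t ∈ S \ {i, j})
    (hinj : ∀ t t', 1 ≤ t → t < t' → t' ≤ s → ℓ t ≠ ℓ t')
    (lam₀ : ↥τ.G.edgeSet → ℝ) (hpos : ∀ ed, 0 < lam₀ ed)
    (heq : ∀ t, 1 ≤ t → t ≤ s →
      eproj τ lam₀ i j (ℓ t) + a (ℓ t) = eproj τ lam₀ i j (ℓ 1) + a (ℓ 1))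
    (hmin : ∀ m ∈ S \ {i, j},
      eproj τ lam₀ i j (ℓ 1) + a (ℓ 1) ≤ eproj τ lam₀ i j m + a m) :
    -- the `s − 1` difference functionals are linearly independent …
    (∀ c : ℕ → ℝ,
      (∀ lam : ↥τ.G.edgeSet → ℝ,
        (∑ t ∈ Finset.Icc 2 s,
          c t * (eproj τ lam i j (ℓ t) - eproj τ lam i j (ℓ 1))) = 0) →
      ∀ t, 2 ≤ t → t ≤ s → c t = 0) ∧
    -- … consequently the solution set is an affine subspace of codimension
    -- exactly `s − 1`
    ∃ W : Submodule ℝ (↥τ.G.edgeSet → ℝ),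
      (∀ lam : ↥τ.G.edgeSet → ℝ,
        ((∀ t, 2 ≤ t → t ≤ s →
          eproj τ lam i j (ℓ t) + a (ℓ t) = eproj τ lam i j (ℓ 1) + a (ℓ 1)) ↔
        lam - lam₀ ∈ W)) ∧
      Module.finrank ℝ W + (s - 1) = Module.finrank ℝ (↥τ.G.edgeSet → ℝ) := by
  have hdual : ∀ t ∈ Finset.Icc 2 s, ∃ lam, ∀ t' ∈ Finset.Icc 2 s,
      eproj τ lam i j (ℓ t') - eproj τ lam i j (ℓ 1) = if t' = t then 1 else 0 := by
    intro t ht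
    rw [Finset.mem_Icc] at ht
    have hsep : ∀ t t' : Finset.Icc 1 s, t ≠ t' →
        eproj τ lam₀ i j (ℓ t) ≠ eproj τ lam₀ i j (ℓ t') := by
      rintro ⟨t, ht⟩ ⟨t', ht'⟩ hne heq'
      rw [Finset.mem_Icc] at ht ht'
      have hℓ : ℓ t ≠ ℓ t' := by
        rcases lt_or_gt_of_ne (fun h => hne (Subtype.ext h) : t ≠ t') with h | h
        · exact hinj t t' ht.1 h ht'.2
        · exact (hinj t' t ht'.1 h ht.2).symm
      have h1 := heq t ht.1 ht.2
      have h2 := heq t' ht'.1 ht'.2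
      refine ha _ (hmem t ht.1 ht.2) _ (hmem t' ht'.1 ht'.2) hℓ ?_
      simp only at heq'
      linarith
    obtain ⟨lam, hlam⟩ := exists_eproj_sub_eq_ite τ i j (fun t : Finset.Icc 1 s => ℓ t)
      ⟨1, Finset.mem_Icc.2 ⟨le_rfl, hs⟩⟩ lam₀ hsep
      ⟨t, Finset.mem_Icc.2 ⟨by omega, ht.2⟩⟩ (fun h => by
        have := congrArg Subtype.val h
        simp only at this
        omega)
    refine ⟨lam, fun t' ht' => ?_⟩
    rw [Finset.mem_Icc] at ht'
    simpa using hlam ⟨t', Finset.mem_Icc.2 ⟨by omega, ht'.2⟩⟩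
  refine ⟨fun c hc t h2 hts => ?_, ?_⟩
  · have ht : t ∈ Finset.Icc 2 s := Finset.mem_Icc.2 ⟨h2, hts⟩
    obtain ⟨lam, hlam⟩ := hdual t ht
    have h := hc lam
    rw [Finset.sum_congr rfl fun t' ht' => by rw [hlam t' ht']] at h
    simpa [h2, hts] using h
  · let Φ : (↥τ.G.edgeSet → ℝ) →ₗ[ℝ] (Finset.Icc 2 s → ℝ) :=
      LinearMap.pi fun t => eprojLinear τ i j (ℓ t) - eprojLinear τ i j (ℓ 1)
    have hsurj : LinearMap.range Φ = ⊤ := by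
      rw [LinearMap.range_eq_top]
      intro c
      choose f hf using fun t : Finset.Icc 2 s => hdual t t.2
      refine ⟨∑ t, c t • f t, ?_⟩
      rw [map_sum]
      funext t'
      have hΦ : ∀ t, Φ (f t) t' = if t' = t then 1 else 0 := fun t => by
        simp only [Subtype.ext_iff]
        exact hf t t' t'.2
      simp [hΦ]
    refine ⟨LinearMap.ker Φ, fun lam => ?_, ?_⟩
    · rw [LinearMap.mem_ker, map_sub, sub_eq_zero, funext_iff]
      have hΦ : ∀ lam t, Φ lam t = eproj τ lam i j (ℓ t) - eproj τ lam i j (ℓ 1) :=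
        fun _ _ => rfl
      constructor
      · rintro h ⟨t, ht⟩
        have ht' := Finset.mem_Icc.1 ht
        have h1 := h t ht'.1 ht'.2
        have h2 := heq t (by omega) ht'.2
        rw [hΦ, hΦ]
        linarith
      · intro h t h2 hts
        have h1 := h ⟨t, Finset.mem_Icc.2 ⟨h2, hts⟩⟩
        have h2 := heq t (by omega) hts
        rw [hΦ, hΦ] at h1
        linarith
    · have h := Φ.finrank_range_add_finrank_ker
      rw [hsurj, finrank_top, Module.finrank_fintype_fun_eq_card, Fintype.card_coe,
        Nat.card_Icc] at h
      omega

end TropPsi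
end

section
/- Let r ≥ 1 and n ≥ 1 be integers, c an integer, and B a real number with B ≥ 2n+1. Let A be an admissible r×r matrix and let L ∈ ℝ^r have entries L_q = m_q·B^(c−q) for q = 1,…,r, where each m_q is an integer with 1 ≤ m_q ≤ n. Then A is invertible and the unique solution y of A·y = L satisfies (1/2)·B^(c−q) ≤ y_q ≤ n·B^(c−q) for every q ∈ {1,…,r}; in particular y_1 > y_2 > ⋯ > y_r > 0. (Paper: Lemma bounding the entries of the edge-length vector of a tuple satisfying condition (*), Section 6, where c = n−3, A is the path matrix with A_{q,q'} = 1 if the edge e_{q'} lies on the path P_q and 0 otherwise, and m_q = ℓ_q − k_q.) -/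
namespace TropPsi

/-- An `r × r` real matrix is *admissible* if it is upper triangular, every
diagonal entry equals `1`, and every entry strictly above the diagonal lies in
`{0, 1}`. -/
def Admissible {r : ℕ} (A : Matrix (Fin r) (Fin r) ℝ) : Prop :=
  (∀ q q' : Fin r, q' < q → A q q' = 0) ∧
  (∀ q : Fin r, A q q = 1) ∧
  (∀ q q' : Fin r, q < q' → A q q' = 0 ∨ A q q' = 1)

theorem Admissible.isUnit {r : ℕ} {A : Matrix (Fin r) (Fin r) ℝ} (hA : Admissible A) :
    IsUnit A := by
  have hT : A.BlockTriangular id := fun i j hij => hA.1 i j hij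
  rw [Matrix.isUnit_iff_isUnit_det, Matrix.det_of_isUpperTriangular hT]
  simp [hA.2.1]

theorem Admissible.mulVec_apply {r : ℕ} {A : Matrix (Fin r) (Fin r) ℝ} (hA : Admissible A)
    (y : Fin r → ℝ) (q : Fin r) :
    A.mulVec y q = y q + ∑ j ∈ Finset.Ioi q, A q j * y j := by
  have hsub : ∑ j ∈ Finset.Ici q, A q j * y j = ∑ j, A q j * y j := by
    refine Finset.sum_subset (Finset.subset_univ _) fun j _ hj => ?_
    rw [hA.1 q j (by simpa using hj), zero_mul]
  rw [Matrix.mulVec, dotProduct, ← hsub, ← Finset.Ioi_insert,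
    Finset.sum_insert (by simp), hA.2.1, one_mul]

theorem geom_tail_mul_sub_one {B : ℝ} (hB : B ≠ 0) (c : ℤ) {a r : ℕ} (h : a ≤ r) :
    (B - 1) * ∑ k ∈ Finset.Ico a r, B ^ (c - (k : ℤ) - 1) =
      B ^ (c - (a : ℤ)) - B ^ (c - (r : ℤ)) := by
  induction r, h using Nat.le_induction with
  | base => simp
  | succ k hk ih =>
    have hstep : B ^ (c - (k : ℤ)) = B ^ (c - (k : ℤ) - 1) * B := by
      rw [← zpow_add_one₀ hB, sub_add_cancel]
    rw [Finset.sum_Ico_succ_top hk, mul_add, ih, hstep, Nat.cast_succ, ← sub_sub]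
    ring

theorem sub_one_mul_sum_Ioi_le {B : ℝ} (hB : 0 < B) (c : ℤ) {r : ℕ} (q : Fin r) :
    (B - 1) * ∑ j ∈ Finset.Ioi q, B ^ (c - ((j : ℕ) : ℤ) - 1) ≤ B ^ (c - ((q : ℕ) : ℤ) - 1) := by
  have hmap : ∑ j ∈ Finset.Ioi q, B ^ (c - ((j : ℕ) : ℤ) - 1)
      = ∑ k ∈ Finset.Ico ((q : ℕ) + 1) r, B ^ (c - (k : ℤ) - 1) := by
    have hset : Finset.Ico ((q : ℕ) + 1) r = (Finset.Ioi q).map Fin.valEmbedding := by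
      rw [Fin.map_valEmbedding_Ioi]
      ext k
      simp
    rw [hset, Finset.sum_map]
    rfl
  rw [hmap, geom_tail_mul_sub_one hB.ne' c (Nat.succ_le_of_lt q.isLt), Nat.cast_succ, ← sub_sub]
  exact sub_le_self _ (zpow_nonneg hB.le _)

theorem Admissible.solution_bounds {r n : ℕ} (hn : 1 ≤ n) (c : ℤ) {B : ℝ}
    (hB : 2 * (n : ℝ) + 1 ≤ B) {A : Matrix (Fin r) (Fin r) ℝ} (hA : Admissible A)
    {m : Fin r → ℤ} (hm : ∀ q, 1 ≤ m q ∧ m q ≤ n) {y : Fin r → ℝ}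
    (hy : ∀ q, A.mulVec y q = (m q : ℝ) * B ^ (c - ((q : ℕ) : ℤ) - 1)) (q : Fin r) :
    (1 / 2 : ℝ) * B ^ (c - ((q : ℕ) : ℤ) - 1) ≤ y q ∧
      y q ≤ (n : ℝ) * B ^ (c - ((q : ℕ) : ℤ) - 1) := by
  have hn' : (1 : ℝ) ≤ n := by exact_mod_cast hn
  have hB0 : 0 < B := by linarith
  have hpos : ∀ k : ℤ, 0 < B ^ k := fun k => zpow_pos hB0 k
  induction q using WellFoundedGT.induction with
  | ind q ih =>
    have hterm : ∀ j ∈ Finset.Ioi q, 0 ≤ A q j * y j ∧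
        A q j * y j ≤ (n : ℝ) * B ^ (c - ((j : ℕ) : ℤ) - 1) := by
      intro j hj
      have hqj : q < j := Finset.mem_Ioi.mp hj
      obtain ⟨hlow, hupp⟩ := ih j hqj
      have hj0 := hpos (c - ((j : ℕ) : ℤ) - 1)
      have hy0 : 0 ≤ y j := by linarith
      rcases hA.2.2 q j hqj with h | h <;> rw [h]
      · simpa using by positivity
      · simpa using ⟨hy0, hupp⟩
    have hsum0 := Finset.sum_nonneg fun j hj => (hterm j hj).1
    have hsum1 := Finset.sum_le_sum fun j hj => (hterm j hj).2
    rw [← Finset.mul_sum] at hsum1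
    have hgeom := sub_one_mul_sum_Ioi_le hB0 c q
    have htail : 2 * (n : ℝ) * ∑ j ∈ Finset.Ioi q, B ^ (c - ((j : ℕ) : ℤ) - 1)
        ≤ B ^ (c - ((q : ℕ) : ℤ) - 1) :=
      (mul_le_mul_of_nonneg_right (by linarith)
        (Finset.sum_nonneg fun j _ => (hpos _).le)).trans hgeom
    have hrow := hy q
    rw [hA.mulVec_apply] at hrow
    have hm1 : (1 : ℝ) ≤ m q := by exact_mod_cast (hm q).1
    have hm2 : (m q : ℝ) ≤ n := by exact_mod_cast (hm q).2
    have hL1 := mul_le_mul_of_nonneg_right hm1 (hpos (c - ((q : ℕ) : ℤ) - 1)).le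
    have hL2 := mul_le_mul_of_nonneg_right hm2 (hpos (c - ((q : ℕ) : ℤ) - 1)).le
    constructor <;> linarith

/-- Lemma bounding the entries of the edge-length vector of a
tuple satisfying condition `(*)`, Section 6.  The index `q ∈ {1,…,r}` of the
paper corresponds to `q : Fin r` with numerical value `q + 1`. -/
theorem statement_13
    (r n : ℕ) (hr : 1 ≤ r) (hn : 1 ≤ n) (c : ℤ)
    (B : ℝ) (hB : 2 * (n : ℝ) + 1 ≤ B)
    (A : Matrix (Fin r) (Fin r) ℝ) (hA : Admissible A)
    (m : Fin r → ℤ) (hm : ∀ q, 1 ≤ m q ∧ m q ≤ n)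
    (L : Fin r → ℝ)
    (hL : ∀ q : Fin r, L q = (m q : ℝ) * B ^ (c - ((q : ℕ) : ℤ) - 1)) :
    IsUnit A ∧
    ∀ y : Fin r → ℝ, A.mulVec y = L →
      (∀ q : Fin r,
        (1 / 2 : ℝ) * B ^ (c - ((q : ℕ) : ℤ) - 1) ≤ y q ∧
        y q ≤ (n : ℝ) * B ^ (c - ((q : ℕ) : ℤ) - 1)) ∧
      (∀ q q' : Fin r, q < q' → y q' < y q) ∧
      (∀ q : Fin r, 0 < y q) := by
  have hn' : (1 : ℝ) ≤ n := by exact_mod_cast hn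
  have hB0 : 0 < B := by linarith
  have hpos : ∀ k : ℤ, 0 < B ^ k := fun k => zpow_pos hB0 k
  refine ⟨hA.isUnit, fun y hy => ?_⟩
  have hbd := hA.solution_bounds hn c hB hm fun q => (congrFun hy q).trans (hL q)
  refine ⟨hbd, fun q q' hqq' => ?_, fun q => ?_⟩
  · have hexp : B ^ (c - ((q' : ℕ) : ℤ) - 1 + 1) ≤ B ^ (c - ((q : ℕ) : ℤ) - 1) :=
      zpow_le_zpow_right₀ (by linarith) (by have : (q : ℕ) < q' := hqq'; omega)
    rw [zpow_add_one₀ hB0.ne'] at hexp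
    have hq' := hpos (c - ((q' : ℕ) : ℤ) - 1)
    have hmul := mul_le_mul_of_nonneg_left hB hq'.le
    linarith [(hbd q).1, (hbd q').2]
  · linarith [(hbd q).1, hpos (c - ((q : ℕ) : ℤ) - 1)]

end TropPsi
end

section
/- Let r ≥ 1 and let A be an admissible r×r real matrix. Then A is invertible, its inverse A^{−1} is upper triangular with all diagonal entries equal to 1, and the entries of A^{−1} satisfy |(A^{−1})_{q,q'}| ≤ 2^(q'−q−1) for all indices q < q'. (Paper: bound on the entries of the inverse of a path matrix, established in the proof of the Lemma comparing the metrics of a tree and its contraction, Section 8.) -/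
namespace TropPsi

namespace Admissible

variable {r : ℕ} {A : Matrix (Fin r) (Fin r) ℝ}

theorem blockTriangular (hA : Admissible A) : A.BlockTriangular id :=
  fun q q' h => hA.1 q q' h

theorem det_eq_one (hA : Admissible A) : A.det = 1 := by
  rw [Matrix.det_of_isUpperTriangular hA.blockTriangular]
  exact Finset.prod_eq_one fun q _ => hA.2.1 q

theorem isUnit_det (hA : Admissible A) : IsUnit A.det := by
  rw [hA.det_eq_one]
  exact isUnit_one

theorem inv_apply_of_lt (hA : Admissible A) {q q' : Fin r} (h : q' < q) : A⁻¹ q q' = 0 := by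
  let := A.invertibleOfIsUnitDet hA.isUnit_det
  exact Matrix.blockTriangular_inv_of_blockTriangular hA.blockTriangular h

theorem abs_apply_le_one (hA : Admissible A) {q q' : Fin r} (h : q < q') : |A q q'| ≤ 1 := by
  rcases hA.2.2 q q' h with h | h <;> simp [h]

/-- The `q`-th row of `A * A⁻¹ = 1`, solved for the entry of `A⁻¹` in that row. -/
theorem inv_apply_eq (hA : Admissible A) (q q' : Fin r) :
    A⁻¹ q q' = (1 : Matrix (Fin r) (Fin r) ℝ) q q' - ∑ j ∈ Finset.Ioi q, A q j * A⁻¹ j q' := by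
  have hsum : ∑ j, A q j * A⁻¹ j q' = ∑ j ∈ Finset.Ici q, A q j * A⁻¹ j q' := by
    refine (Finset.sum_subset (Finset.subset_univ _) fun j _ hj => ?_).symm
    rw [hA.1 q j (by simpa using hj), zero_mul]
  rw [← A.mul_nonsing_inv hA.isUnit_det, Matrix.mul_apply, hsum, ← Finset.Ioi_insert,
    Finset.sum_insert (by simp), hA.2.1 q]
  ring

theorem inv_apply_self (hA : Admissible A) (q : Fin r) : A⁻¹ q q = 1 := by
  rw [hA.inv_apply_eq, Matrix.one_apply_eq, Finset.sum_eq_zero, sub_zero]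
  intro j hj
  rw [hA.inv_apply_of_lt (Finset.mem_Ioi.mp hj), mul_zero]

theorem abs_inv_apply_le_sum (hA : Admissible A) {q q' : Fin r} (h : q < q') :
    |A⁻¹ q q'| ≤ ∑ j ∈ Finset.Ioi q, |A⁻¹ j q'| := by
  rw [hA.inv_apply_eq, Matrix.one_apply_ne h.ne, zero_sub, abs_neg]
  refine (Finset.abs_sum_le_sum_abs _ _).trans (Finset.sum_le_sum fun j hj => ?_)
  rw [abs_mul]
  exact mul_le_of_le_one_left (abs_nonneg _) (hA.abs_apply_le_one (Finset.mem_Ioi.mp hj))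

theorem sum_Ioi_abs_inv_apply_le (hA : Admissible A) (k : ℕ) {q q' : Fin r}
    (h : (q' : ℕ) = q + k + 1) : ∑ j ∈ Finset.Ioi q, |A⁻¹ j q'| ≤ 2 ^ k := by
  induction k generalizing q with
  | zero =>
    rw [Finset.sum_eq_single q', hA.inv_apply_self]
    · simp
    · intro j hj hne
      have hj' := Finset.mem_Ioi.mp hj
      rw [hA.inv_apply_of_lt (by grind), abs_zero]
    · intro hq
      exact absurd (Finset.mem_Ioi.mpr (by grind)) hq
  | succ k ih =>
    let p : Fin r := ⟨q + 1, by grind⟩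
    have hp : Finset.Ioi q = insert p (Finset.Ioi p) := by
      ext j
      simp only [Finset.mem_insert, Finset.mem_Ioi, Fin.lt_def, Fin.ext_iff, p]
      omega
    have hle := ih (q := p) (by simp only [p]; omega)
    have hlt : p < q' := Fin.lt_def.mpr (by simp only [p]; omega)
    rw [hp, Finset.sum_insert (by simp), pow_succ]
    linarith [hA.abs_inv_apply_le_sum hlt]

end Admissible

/-- bound on the entries of the inverse of a path matrix,
Section 8. -/
theorem statement_14
    (r : ℕ) (hr : 1 ≤ r)
    (A : Matrix (Fin r) (Fin r) ℝ) (hA : Admissible A) :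
    IsUnit A ∧ A⁻¹ * A = 1 ∧
    (∀ q q' : Fin r, q' < q → A⁻¹ q q' = 0) ∧
    (∀ q : Fin r, A⁻¹ q q = 1) ∧
    (∀ q q' : Fin r, q < q' →
      |A⁻¹ q q'| ≤ (2 : ℝ) ^ ((q' : ℕ) - (q : ℕ) - 1)) := by
  refine ⟨(Matrix.isUnit_iff_isUnit_det A).mpr hA.isUnit_det,
    A.nonsing_inv_mul hA.isUnit_det, fun _ _ => hA.inv_apply_of_lt, hA.inv_apply_self,
    fun q q' h => (hA.abs_inv_apply_le_sum h).trans (hA.sum_Ioi_abs_inv_apply_le _ ?_)⟩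
  have := Fin.lt_def.mp h
  omega

end TropPsi
end
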